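/- arXiv:1106.2949 — 5 statements merged into one kernel-verified Lean document; each statement's English description precedes it below -/
import Mathlib

section
/- Let n ≥ 2 be an even natural number with n ≠ 4, let P be a Sylow 2-subgroup of the symmetric group 𝔖_n, and set Q := P ∩ 𝔄_n (so that Q is a Sylow 2-subgroup of the alternating group 𝔄_n). Then the centralizer of Q in 𝔖_n equals the center of P, regarded as a subgroup of 𝔖_n: C_{𝔖_n}(Q) = Z(P). -/
open Equiv

/-- The permutations that preserve each of the pairs `{x, ν x}` of a fixed-point-free
involution `ν`. -/
def pairwiseStabilizer {α : Type*} (ν : Perm α) (hν : ∀ x, ν (ν x) = x) (hν' : ∀ x, ν x ≠ x) :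
    Subgroup (Perm α) where
  carrier := {g | ∀ x, g x = x ∨ g x = ν x}
  one_mem' x := Or.inl rfl
  mul_mem' {g h} hg hh x := by
    have h1 := hh x
    have h2 := hg (h x)
    have h3 := hν x
    simp only [Perm.mul_apply]
    grind
  inv_mem' {g} hg x := by
    have h1 := hg (g⁻¹ x)
    have h2 := hν (g⁻¹ x)
    have h3 := hg x
    have h4 := hν' x
    rw [show g (g⁻¹ x) = x from g.apply_symm_apply x] at h1
    grind

section

variable {α : Type*} {ν : Perm α} {hν : ∀ x, ν (ν x) = x} {hν' : ∀ x, ν x ≠ x}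

theorem mem_pairwiseStabilizer {g : Perm α} :
    g ∈ pairwiseStabilizer ν hν hν' ↔ ∀ x, g x = x ∨ g x = ν x :=
  Iff.rfl

theorem sq_eq_one_of_mem_pairwiseStabilizer {g : Perm α}
    (hg : g ∈ pairwiseStabilizer ν hν hν') : g ^ 2 = 1 := by
  ext x
  have h1 := hg x
  have h2 := hg (g x)
  have h3 := hν x
  have h4 := hν' x
  have h5 : g (g x) = g x → g x = x := fun h => g.injective h
  simp only [sq, Perm.mul_apply, Perm.one_apply]
  grind

theorem isPGroup_pairwiseStabilizer : IsPGroup 2 (pairwiseStabilizer ν hν hν') := fun g =>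
  ⟨1, Subtype.ext (by simpa using sq_eq_one_of_mem_pairwiseStabilizer g.2)⟩

theorem swap_mem_pairwiseStabilizer [DecidableEq α] (a : α) :
    swap a (ν a) ∈ pairwiseStabilizer ν hν hν' := fun x => by
  have := hν a
  rw [swap_apply_def]
  grind

theorem commute_swap_of_mem_pairwiseStabilizer [DecidableEq α] {g : Perm α}
    (hg : g ∈ pairwiseStabilizer ν hν hν') (a : α) : Commute g (swap a (ν a)) := by
  have h : swap (g a) (g (ν a)) = swap a (ν a) := by
    have h1 := hg a
    have h2 := hg (ν a)
    have h3 := hν a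
    have h4 := hν' a
    have h5 : g (ν a) = g a → ν a = a := fun h => g.injective h
    have h6 := swap_comm a (ν a)
    grind
  rw [Commute, SemiconjBy, mul_swap_eq_swap_mul, h]

/-- Among at least three pairs, a permutation commuting with all products of two of the
transpositions `swap x (ν x)` preserves every pair. -/
theorem mem_pairwiseStabilizer_of_commute_swap_mul_swap [Fintype α] [DecidableEq α]
    (hcard : 4 < Fintype.card α) {g : Perm α}
    (hg : ∀ a c, Commute g (swap a (ν a) * swap c (ν c))) :
    g ∈ pairwiseStabilizer ν hν hν' := fun a => by
  by_contra! hne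
  obtain ⟨c, hc⟩ : ∃ c, c ∉ ({a, ν a, g a, ν (g a)} : Finset α) := by
    by_contra! h
    have := Finset.card_le_card (fun x _ => h x : Finset.univ ⊆ _)
    rw [Finset.card_univ] at this
    exact absurd (this.trans Finset.card_le_four) (by omega)
  simp only [Finset.mem_insert, Finset.mem_singleton, not_or] at hc
  obtain ⟨hca, hcν, hcg, hcνg⟩ := hc
  have hνa : ∀ x y, ν x = y → x = ν y := fun x y h => by rw [← h, hν]
  have h := congrArg (fun f : Perm α => f a) (hg a c).eq
  simp only [Perm.mul_apply] at h
  rw [swap_apply_of_ne_of_ne (Ne.symm hca) (fun e => hcν (hνa _ _ e.symm)), swap_apply_left,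
    swap_apply_of_ne_of_ne (Ne.symm hcg) (fun e => hcνg (hνa _ _ e.symm)),
    swap_apply_of_ne_of_ne hne.1 hne.2] at h
  exact hν' a (g.injective h)

theorem mem_pairwiseStabilizer_of_card_le_two [Fintype α] [DecidableEq α]
    (hcard : Fintype.card α ≤ 2) (g : Perm α) : g ∈ pairwiseStabilizer ν hν hν' := fun a => by
  have h : ({a, ν a} : Finset α) = Finset.univ := by
    rw [← Finset.card_eq_iff_eq_univ]
    exact le_antisymm (Finset.card_le_univ _) (by rwa [Finset.card_pair (hν' a).symm])
  have hga := Finset.mem_univ (g a)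
  rw [← h] at hga
  simpa using hga

end

/-- A Sylow `2`-subgroup of `𝔖_n`, `n` even, contains `n / 2` disjoint transpositions. -/
theorem Sylow.exists_involution_swap_mem {n : ℕ} (heven : Even n) (P : Sylow 2 (Perm (Fin n))) :
    ∃ ν : Perm (Fin n), (∀ x, ν (ν x) = x) ∧ (∀ x, ν x ≠ x) ∧ ∀ x, swap x (ν x) ∈ P := by
  have hrev : ∀ x : Fin n, Fin.revPerm x ≠ x := fun x h => by
    have := congrArg Fin.val h
    simp only [Fin.revPerm_apply, Fin.val_rev] at this
    obtain ⟨k, rfl⟩ := heven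
    omega
  obtain ⟨S, hS⟩ := (isPGroup_pairwiseStabilizer
    (hν := fun x => by simp) (hν' := hrev)).exists_le_sylow
  obtain ⟨g, rfl⟩ := MulAction.exists_smul_eq (Perm (Fin n)) S P
  refine ⟨(g * Fin.revPerm * g⁻¹ : Perm (Fin n)), fun x => by simp, fun x h => hrev (g⁻¹ x) ?_, fun x => ?_⟩
  · exact g.injective (by simpa using h)
  · have h : swap x ((g * Fin.revPerm * g⁻¹ : Perm (Fin n)) x)
        = MulAut.conj g (swap (g⁻¹ x) (Fin.revPerm (g⁻¹ x))) := by
      simp [MulAut.conj_apply, mul_swap_eq_swap_mul]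
    rw [h]
    exact Subgroup.smul_mem_pointwise_smul _ (MulAut.conj g) _
      (hS (swap_mem_pairwiseStabilizer _))


/-- Let `n ≥ 2` be even with `n ≠ 4`, let `P` be a Sylow `2`-subgroup of
the symmetric group `𝔖_n` (a `2`-subgroup of maximal possible order), and let
`Q := P ⊓ 𝔄_n`. Then the centralizer of `Q` in `𝔖_n` equals the center
`Z(P) = C_{𝔖_n}(P) ⊓ P` of `P`, regarded as a subgroup of `𝔖_n`. -/
theorem centralizer_sylow_two_inter_alternating_eq_center
    (n : ℕ) (hn2 : 2 ≤ n) (heven : Even n) (hn4 : n ≠ 4)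
    (P : Subgroup (Equiv.Perm (Fin n))) (hP2 : IsPGroup 2 P)
    (hPmax : ∀ R : Subgroup (Equiv.Perm (Fin n)), IsPGroup 2 R → Nat.card R ≤ Nat.card P) :
    Subgroup.centralizer
        ((P ⊓ alternatingGroup (Fin n) : Subgroup (Equiv.Perm (Fin n))) :
          Set (Equiv.Perm (Fin n)))
      = Subgroup.centralizer (P : Set (Equiv.Perm (Fin n))) ⊓ P := by
  let S : Sylow 2 (Perm (Fin n)) := ⟨P, hP2, fun {R} hR hle =>
    (Subgroup.eq_of_le_of_card_ge hle (hPmax R hR)).symm⟩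
  obtain ⟨ν, hν, hν', hswap⟩ := S.exists_involution_swap_mem heven
  have hsign : ∀ x, Perm.sign (swap x (ν x)) = -1 := fun x => Perm.sign_swap (hν' x).symm
  apply le_antisymm
  · intro z hz
    have hzQ : ∀ q ∈ P, Perm.sign q = 1 → q * z = z * q := fun q hq hs =>
      Subgroup.mem_centralizer_iff.mp hz q ⟨hq, Perm.mem_alternatingGroup.mpr hs⟩
    have hzν : z ∈ pairwiseStabilizer ν hν hν' := by
      by_cases hn : n = 2
      · exact mem_pairwiseStabilizer_of_card_le_two (by simp [hn]) z
      · refine mem_pairwiseStabilizer_of_commute_swap_mul_swap ?_ fun a c =>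
          (hzQ _ (P.mul_mem (hswap a) (hswap c)) (by simp [hsign])).symm
        rw [Fintype.card_fin]
        obtain ⟨k, rfl⟩ := heven
        omega
    have hzP : z ∈ Subgroup.centralizer (P : Set (Perm (Fin n))) := by
      refine Subgroup.mem_centralizer_iff.mpr fun p hp => ?_
      rcases Int.units_eq_one_or (Perm.sign p) with hs | hs
      · exact hzQ p hp hs
      · let x : Fin n := ⟨0, by omega⟩
        have h : Commute z (p * swap x (ν x)) :=
          (hzQ _ (P.mul_mem hp (hswap x)) (by simp [hsign, hs])).symm
        have h' := h.mul_right (commute_swap_of_mem_pairwiseStabilizer hzν x)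
        rw [mul_assoc, swap_mul_self, mul_one] at h'
        exact h'.symm
    refine ⟨hzP, ?_⟩
    have hz2 : IsPGroup 2 (Subgroup.zpowers z) :=
      isPGroup_pairwiseStabilizer.to_le (Subgroup.zpowers_le.mpr hzν)
    have hmem : z ∈ Subgroup.zpowers z ⊓ Subgroup.normalizer (S : Set (Perm (Fin n))) :=
      ⟨Subgroup.mem_zpowers z, Subgroup.centralizer_le_normalizer _ hzP⟩
    rw [hz2.inf_normalizer_sylow] at hmem
    exact hmem.2
  · exact inf_le_left.trans (Subgroup.centralizer_le inf_le_left)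
end

section
/- Let n ≥ 4 be a natural number divisible by 4 and let Q be a Sylow 2-subgroup of the alternating group 𝔄_n. Then the centralizer of Q in the symmetric group 𝔖_n, the centralizer of Q in 𝔄_n, and the center of Q all coincide: C_{𝔖_n}(Q) = C_{𝔄_n}(Q) = Z(Q). -/
/-- The blockwise translation action of `ι → V` on a set identified with `ι × V`. -/
def blockTranslation {ι V α : Type*} [AddGroup V] (e : ι × V ≃ α) :
    Multiplicative (ι → V) →* Equiv.Perm α :=
  e.permCongrHom.toMonoidHom.comp
    { toFun := fun f => Equiv.prodCongrRight fun i => Equiv.addLeft (f.toAdd i)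
      map_one' := by ext x <;> simp
      map_mul' := fun f g => by ext x <;> simp }

theorem blockTranslation_apply {ι V α : Type*} [AddGroup V] (e : ι × V ≃ α)
    (f : Multiplicative (ι → V)) (i : ι) (v : V) :
    blockTranslation e f (e (i, v)) = e (i, f.toAdd i + v) := by
  simp [blockTranslation]

theorem centralizer_range_blockTranslation_le {ι V α : Type*} [AddCommGroup V] [Nontrivial V]
    (e : ι × V ≃ α) :
    Subgroup.centralizer ((blockTranslation e).range : Set (Equiv.Perm α)) ≤
      (blockTranslation e).range := by
  classical
  intro σ hσ
  have hcomm (f : ι → V) (x : α) : blockTranslation e (.ofAdd f) (σ x) =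
      σ (blockTranslation e (.ofAdd f) x) :=
    DFunLike.congr_fun (Subgroup.mem_centralizer_iff.mp hσ _ ⟨_, rfl⟩) x
  have hfst (i : ι) (v : V) : (e.symm (σ (e (i, v)))).1 = i := by
    by_contra hne
    obtain ⟨j, w, hjw⟩ : ∃ j w, σ (e (i, v)) = e (j, w) :=
      ⟨_, _, (e.apply_symm_apply (σ (e (i, v)))).symm⟩
    have hji : j ≠ i := by simpa [hjw] using hne
    obtain ⟨u, hu⟩ := exists_ne (0 : V)
    have h := hcomm (Pi.single i u) (e (i, v))
    rw [blockTranslation_apply, hjw, blockTranslation_apply] at h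
    simp only [toAdd_ofAdd, Pi.single_eq_same, Pi.single_eq_of_ne hji, zero_add, ← hjw,
      EmbeddingLike.apply_eq_iff_eq, Prod.mk.injEq, true_and] at h
    exact hu (by simpa using h)
  refine ⟨.ofAdd fun i => (e.symm (σ (e (i, 0)))).2, ?_⟩
  ext x
  obtain ⟨⟨i, v⟩, rfl⟩ := e.surjective x
  have h := hcomm (fun _ => v) (e (i, 0))
  have h0 : σ (e (i, 0)) = e (i, (e.symm (σ (e (i, 0)))).2) := by
    rw [← Equiv.symm_apply_eq]
    exact Prod.ext (hfst i 0) rfl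
  rw [h0, blockTranslation_apply, blockTranslation_apply] at h
  rw [blockTranslation_apply]
  simpa [add_comm] using h

theorem isPGroup_range_blockTranslation {ι α : Type*} (e : ι × (ZMod 2 × ZMod 2) ≃ α) :
    IsPGroup 2 (blockTranslation e).range := by
  rintro ⟨_, f, rfl⟩
  refine ⟨1, Subtype.ext ?_⟩
  have hf : f ^ 2 = 1 := by
    rw [← toAdd_eq_zero, toAdd_pow]
    funext i
    exact (by decide : ∀ v : ZMod 2 × ZMod 2, 2 • v = 0) (f.toAdd i)
  simp [← map_pow, hf]

theorem range_blockTranslation_le_alternatingGroup {ι α : Type*} [Fintype ι] [DecidableEq ι]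
    [Fintype α] [DecidableEq α] (e : ι × (ZMod 2 × ZMod 2) ≃ α) :
    (blockTranslation e).range ≤ alternatingGroup α := by
  rintro _ ⟨f, rfl⟩
  have hv : ∀ v : ZMod 2 × ZMod 2, Equiv.Perm.sign (Equiv.addLeft v) = 1 := by decide
  simp [blockTranslation, Equiv.Perm.mem_alternatingGroup, Equiv.Perm.sign_permCongr,
    Equiv.Perm.sign_prodCongrRight, hv]

/-- A `p`-subgroup of `A` of maximal order contains a conjugate of every `p`-subgroup of `A`. -/
theorem exists_conj_mem_of_card_maximal {G : Type*} [Group G] [Finite G] {p : ℕ}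
    [Fact p.Prime] {A Q R : Subgroup G} (hQA : Q ≤ A) (hQ : IsPGroup p Q)
    (hmax : ∀ S : Subgroup G, S ≤ A → IsPGroup p S → Nat.card S ≤ Nat.card Q)
    (hRA : R ≤ A) (hR : IsPGroup p R) :
    ∃ g : G, ∀ r ∈ R, g * r * g⁻¹ ∈ Q := by
  obtain ⟨S, hS⟩ := (hR.comap_of_injective A.subtype A.subtype_injective).exists_le_sylow
  obtain ⟨T, hT⟩ := (hQ.comap_of_injective A.subtype A.subtype_injective).exists_le_sylow
  obtain ⟨g, hg⟩ := MulAction.exists_smul_eq A S T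
  have hQT : Q ≤ (T : Subgroup A).map A.subtype := fun x hx => ⟨⟨x, hQA hx⟩, hT hx, rfl⟩
  have heq : Q = (T : Subgroup A).map A.subtype := Subgroup.eq_of_le_of_card_ge hQT
    (hmax _ (Subgroup.map_subtype_le _) (T.isPGroup'.map _))
  refine ⟨g, fun r hr => ?_⟩
  rw [heq, ← hg]
  exact ⟨g * ⟨r, hRA hr⟩ * g⁻¹, Subgroup.smul_mem_pointwise_smul _ (MulAut.conj g) _
    (hS (x := ⟨r, hRA hr⟩) hr), rfl⟩

/-- If some `p`-subgroup of `A` contains its own centralizer, so does every `p`-subgroup of `A`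
of maximal order. -/
theorem centralizer_le_of_card_maximal {G : Type*} [Group G] [Finite G] {p : ℕ}
    [Fact p.Prime] {A Q R : Subgroup G} (hQA : Q ≤ A) (hQ : IsPGroup p Q)
    (hmax : ∀ S : Subgroup G, S ≤ A → IsPGroup p S → Nat.card S ≤ Nat.card Q)
    (hRA : R ≤ A) (hR : IsPGroup p R) (hRC : Subgroup.centralizer (R : Set G) ≤ R) :
    Subgroup.centralizer (Q : Set G) ≤ Q := by
  obtain ⟨g, hg⟩ := exists_conj_mem_of_card_maximal hQA hQ hmax hRA hR
  intro x hx
  have hxR : g⁻¹ * x * g ∈ R := by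
    refine hRC (Subgroup.mem_centralizer_iff.mpr fun r hr => ?_)
    have h := Subgroup.mem_centralizer_iff.mp hx _ (hg r hr)
    calc r * (g⁻¹ * x * g) = g⁻¹ * (g * r * g⁻¹ * x) * g := by group
      _ = g⁻¹ * x * g * r := by rw [h]; group
  simpa [mul_assoc] using hg _ hxR


/-- Let `n ≥ 4` be divisible by `4` and let `Q` be a Sylow `2`-subgroup of
the alternating group `𝔄_n` (a `2`-subgroup of `𝔄_n` of maximal possible order). Then
`C_{𝔖_n}(Q) = C_{𝔄_n}(Q) = Z(Q)`, where `C_{𝔄_n}(Q) = C_{𝔖_n}(Q) ⊓ 𝔄_n` and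
`Z(Q) = C_{𝔖_n}(Q) ⊓ Q`. -/
theorem centralizer_sylow_two_alternating_of_four_dvd
    (n : ℕ) (hn4 : 4 ≤ n) (hdvd : 4 ∣ n)
    (Q : Subgroup (Equiv.Perm (Fin n))) (hQA : Q ≤ alternatingGroup (Fin n))
    (hQ2 : IsPGroup 2 Q)
    (hQmax : ∀ R : Subgroup (Equiv.Perm (Fin n)), R ≤ alternatingGroup (Fin n) →
      IsPGroup 2 R → Nat.card R ≤ Nat.card Q) :
    Subgroup.centralizer (Q : Set (Equiv.Perm (Fin n)))
        = Subgroup.centralizer (Q : Set (Equiv.Perm (Fin n))) ⊓ alternatingGroup (Fin n) ∧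
    Subgroup.centralizer (Q : Set (Equiv.Perm (Fin n))) ⊓ alternatingGroup (Fin n)
        = Subgroup.centralizer (Q : Set (Equiv.Perm (Fin n))) ⊓ Q := by
  obtain ⟨m, rfl⟩ := hdvd
  have e : Fin m × (ZMod 2 × ZMod 2) ≃ Fin (4 * m) :=
    Fintype.equivOfCardEq (by simp [mul_comm])
  have hC : Subgroup.centralizer (Q : Set (Equiv.Perm (Fin (4 * m)))) ≤ Q :=
    centralizer_le_of_card_maximal hQA hQ2 hQmax (range_blockTranslation_le_alternatingGroup e)
      (isPGroup_range_blockTranslation e) (centralizer_range_blockTranslation_le e)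
  rw [inf_eq_left.mpr (hC.trans hQA), inf_eq_left.mpr hC]
  exact ⟨rfl, rfl⟩
end

section
/- Let n ≥ 2 be a natural number with n ≡ 2 (mod 4) and let Q be a Sylow 2-subgroup of the alternating group 𝔄_n. Then C_{𝔄_n}(Q) = Z(Q), and there exists a transposition τ ∈ 𝔖_n commuting with every element of Q such that C_{𝔖_n}(Q) is the internal direct product of Z(Q) and the subgroup ⟨τ⟩ of order 2; in particular, |C_{𝔖_n}(Q)| = 2·|Z(Q)| and every element of C_{𝔖_n}(Q) is of the form z or zτ with z ∈ Z(Q). -/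
open Equiv Equiv.Perm

/-- If `x` moves `O` off itself, the involution exchanging `O` and its image along `x` has sign
`(-1) ^ #O` and commutes with every permutation that commutes with `x` and preserves `O`. -/
theorem Equiv.Perm.exists_exchange {α : Type*} [Fintype α] [DecidableEq α] (x : Perm α)
    (O : Finset α) (hO : ∀ y ∈ O, x y ∉ O) :
    ∃ s : Perm α, s ^ 2 = 1 ∧ (∀ y ∈ O, s y = x y) ∧ sign s = (-1) ^ O.card ∧
      ∀ q : Perm α, Commute q x → (∀ y, q y ∈ O ↔ y ∈ O) → Commute q s := by
  let f : α → α := fun y => if y ∈ O then x y else if x.symm y ∈ O then x.symm y else y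
  have hf : Function.Involutive f := by
    intro y
    by_cases h1 : y ∈ O
    · simp [f, h1, hO y h1]
    · by_cases h2 : x.symm y ∈ O
      · simp [f, h1, h2]
      · simp [f, h1, h2]
  have hs2 : hf.toPerm f ^ 2 = 1 := by
    ext y
    simp [sq, hf y]
  have hsupp : (hf.toPerm f).support = O ∪ O.map x.toEmbedding := by
    ext y
    have hmap : y ∈ O.map x.toEmbedding ↔ x.symm y ∈ O := by
      simp [Finset.mem_map_equiv]
    rw [mem_support, Finset.mem_union, hmap, Function.Involutive.coe_toPerm]
    by_cases h1 : y ∈ O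
    · have : x y ≠ y := fun h => hO y h1 (h.symm ▸ h1)
      simp [f, h1, this]
    · by_cases h2 : x.symm y ∈ O
      · have : x.symm y ≠ y := fun h => h1 (h ▸ h2)
        simp [f, h1, h2, this]
      · simp [f, h1, h2]
  have hdisj : _root_.Disjoint O (O.map x.toEmbedding) := by
    rw [Finset.disjoint_left]
    intro y hy hy'
    obtain ⟨z, hz, rfl⟩ := Finset.mem_map.1 hy'
    exact hO z hz hy
  refine ⟨hf.toPerm f, hs2, fun y hy => by simp [f, hy], ?_, ?_⟩
  · have hcard : (hf.toPerm f).support.card = O.card + O.card := by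
      rw [hsupp, Finset.card_union_of_disjoint hdisj, Finset.card_map]
    have hfix := (hf.toPerm f).card_fixedPoints
    have hle := (hf.toPerm f).support.card_le_univ
    rw [sum_cycleType] at hfix
    rw [sign_of_pow_two_eq_one hs2, hfix]
    congr 1
    omega
  · intro q hqx hqO
    have hqx' : ∀ y, q (x y) = x (q y) := fun y => congrArg (fun g : Perm α => g y) hqx
    have hqi : ∀ y, q (x.symm y) = x.symm (q y) :=
      fun y => congrArg (fun g : Perm α => g y) hqx.inv_right
    ext y
    have h1 := hqO y
    have h2 := hqO (x.symm y)
    simp only [Perm.mul_apply, Function.Involutive.coe_toPerm, f, ← hqi, h1, h2]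
    split_ifs <;> simp [hqx']

/-- A `2`-group of permutations of a set of `n ≡ 2 (mod 4)` points centralizes a transposition. -/
theorem IsPGroup.exists_isSwap_commute {α : Type*} [Fintype α] [DecidableEq α]
    (hmod : Fintype.card α % 4 = 2) {Q : Subgroup (Perm α)} (hQ : IsPGroup 2 Q) :
    ∃ τ : Perm α, τ.IsSwap ∧ ∀ q ∈ Q, Commute τ q := by
  have hodd : ¬ 2 ∣ Nat.card (Set.powersetCard α 2) := by
    rw [Set.powersetCard.card, Nat.card_eq_fintype_card]
    obtain ⟨m, hm⟩ : ∃ m, Fintype.card α = 4 * m + 2 := ⟨Fintype.card α / 4, by omega⟩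
    rw [hm, Nat.choose_two_right]
    have : (4 * m + 2) * (4 * m + 2 - 1) = 2 * (2 * (4 * m ^ 2 + 3 * m) + 1) := by
      rw [show 4 * m + 2 - 1 = 4 * m + 1 by omega]
      ring
    rw [this]
    omega
  obtain ⟨⟨S, hS⟩, hfix⟩ := hQ.nonempty_fixed_point_of_prime_not_dvd_card _ hodd
  obtain ⟨a, b, hab, rfl⟩ := Finset.card_eq_two.1 hS
  refine ⟨swap a b, ⟨a, b, hab, rfl⟩, fun q hq => ?_⟩
  have h := congrArg (fun s : Set.powersetCard α 2 => (s : Finset α)) (hfix ⟨q, hq⟩)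
  have h' : ({q a, q b} : Finset α) = {a, b} := by
    simpa [Finset.smul_finset_insert, Subgroup.smul_def] using h
  have hconj : q * swap a b * q⁻¹ = swap a b := by
    rw [← swap_apply_apply]
    have ha : q a ∈ ({a, b} : Finset α) := h' ▸ by simp
    have hb : q b ∈ ({a, b} : Finset α) := h' ▸ by simp
    have hne : q a ≠ q b := q.injective.ne hab
    simp only [Finset.mem_insert, Finset.mem_singleton] at ha hb
    rcases ha with ha | ha <;> rcases hb with hb | hb
    · exact absurd (ha.trans hb.symm) hne
    · rw [ha, hb]
    · rw [ha, hb, swap_comm]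
    · exact absurd (ha.trans hb.symm) hne
  exact (mul_inv_eq_iff_eq_mul.1 hconj).symm

/-- A maximal `p`-subgroup contains each `p`-element of `A` that commutes with it. -/
theorem Subgroup.mem_of_commute_of_card_maximal {G : Type*} [Group G] [Finite G] {p : ℕ}
    {A Q : Subgroup G} (hQA : Q ≤ A) (hQ : IsPGroup p Q)
    (hQmax : ∀ R : Subgroup G, R ≤ A → IsPGroup p R → Nat.card R ≤ Nat.card Q)
    {g : G} (hgA : g ∈ A) {k : ℕ} (hg : g ^ p ^ k = 1) (hgQ : ∀ q ∈ Q, Commute g q) : g ∈ Q := by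
  have hz : IsPGroup p (Subgroup.zpowers g) := by
    rintro ⟨_, m, rfl⟩
    refine ⟨k, Subtype.ext ?_⟩
    change (g ^ m) ^ p ^ k = 1
    rw [← zpow_natCast, zpow_comm, zpow_natCast, hg, one_zpow]
  have hnorm : Subgroup.zpowers g ≤ Subgroup.normalizer (Q : Set G) := by
    refine le_trans ?_ (Subgroup.centralizer_le_normalizer _)
    rw [Subgroup.zpowers_le, Subgroup.mem_centralizer_iff]
    exact fun q hq => (hgQ q hq).symm
  have hsup := hz.to_sup_of_normal_right' hQ hnorm
  have heq : Q = Subgroup.zpowers g ⊔ Q :=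
    Subgroup.eq_of_le_of_card_ge le_sup_right
      (hQmax _ (sup_le (Subgroup.zpowers_le.2 hgA) hQA) hsup)
  rw [heq]
  exact (le_sup_left : Subgroup.zpowers g ≤ _) (Subgroup.mem_zpowers g)

/-- A Sylow `2`-subgroup of the alternating group on an even number of points, at least `3`,
fixes no point. -/
theorem alternatingGroup.exists_mem_sylow_two_apply_ne {α : Type*} [Fintype α] [DecidableEq α]
    (h3 : 3 ≤ Fintype.card α) (heven : 2 ∣ Fintype.card α)
    {Q : Subgroup (Perm α)} (hQA : Q ≤ alternatingGroup α) (hQ : IsPGroup 2 Q)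
    (hQmax : ∀ R : Subgroup (Perm α), R ≤ alternatingGroup α → IsPGroup 2 R →
      Nat.card R ≤ Nat.card Q) (a : α) : ∃ q ∈ Q, q a ≠ a := by
  by_contra! hfix
  let P : Sylow 2 (alternatingGroup α) :=
    { Q.subgroupOf (alternatingGroup α) with
      isPGroup' := hQ.comap_subtype
      is_maximal' := by
        intro R hR hle
        refine (Subgroup.eq_of_le_of_card_ge hle ?_).symm
        rw [← Subgroup.card_map_of_injective (K := R) (alternatingGroup α).subtype_injective,
          Nat.card_congr (Subgroup.subgroupOfEquivOfLe hQA).toEquiv]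
        exact hQmax _ (Subgroup.map_subtype_le R) (hR.map _) }
  have htrans := alternatingGroup.isPretransitive_of_three_le_card α
    (by rwa [Nat.card_eq_fintype_card])
  have hle : (P : Subgroup (alternatingGroup α)) ≤ MulAction.stabilizer (alternatingGroup α) a :=
    fun g hg => hfix g hg
  have hdvd := Subgroup.index_dvd_of_le hle
  rw [MulAction.index_stabilizer_of_transitive, Nat.card_eq_fintype_card] at hdvd
  exact P.not_dvd_index (heven.trans hdvd)

/-- A permutation centralizing a Sylow `2`-subgroup `Q` of the alternating group on an even number
of points, at least `3`, preserves every orbit of `Q`. -/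
theorem alternatingGroup.apply_mem_orbit_of_commute_sylow_two {α : Type*} [Fintype α]
    [DecidableEq α] (h3 : 3 ≤ Fintype.card α) (heven : 2 ∣ Fintype.card α)
    {Q : Subgroup (Perm α)} (hQA : Q ≤ alternatingGroup α) (hQ : IsPGroup 2 Q)
    (hQmax : ∀ R : Subgroup (Perm α), R ≤ alternatingGroup α → IsPGroup 2 R →
      Nat.card R ≤ Nat.card Q) {x : Perm α} (hx : ∀ q ∈ Q, Commute x q) (a : α) :
    x a ∈ MulAction.orbit Q a := by
  classical
  by_contra hxa
  have hmem : ∀ y, y ∈ (MulAction.orbit Q a).toFinset ↔ ∃ q ∈ Q, q a = y := by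
    simp [MulAction.mem_orbit_iff, Subgroup.smul_def]
  have hinv : ∀ q ∈ Q, ∀ y,
      q y ∈ (MulAction.orbit Q a).toFinset ↔ y ∈ (MulAction.orbit Q a).toFinset := by
    intro q hq y
    rw [Set.mem_toFinset, Set.mem_toFinset]
    rw [← MulAction.orbit_eq_iff, ← MulAction.orbit_eq_iff,
      ← MulAction.orbit_smul (⟨q, hq⟩ : Q) y]
    rfl
  have hoff : ∀ y ∈ (MulAction.orbit Q a).toFinset, x y ∉ (MulAction.orbit Q a).toFinset := by
    intro y hy hxy
    obtain ⟨q, hq, rfl⟩ := (hmem y).1 hy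
    have hc : x (q a) = q (x a) := congrArg (fun g : Perm α => g a) (hx q hq)
    rw [hc, hinv q hq] at hxy
    exact hxa (Set.mem_toFinset.1 hxy)
  obtain ⟨s, hs2, hsx, hsign, hcomm⟩ := x.exists_exchange _ hoff
  have heven : Even (MulAction.orbit Q a).toFinset.card := by
    obtain ⟨k, hk⟩ := hQ.card_orbit a
    rw [Nat.card_eq_card_toFinset] at hk
    rcases k with _ | k
    · obtain ⟨q, hq, hqa⟩ := exists_mem_sylow_two_apply_ne h3 heven hQA hQ hQmax a
      refine absurd (Finset.card_le_one.1 (hk.trans (pow_zero 2)).le _ ((hmem _).2 ⟨q, hq, rfl⟩) a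
        ((hmem a).2 ⟨1, Q.one_mem, rfl⟩)) hqa
    · rw [hk, pow_succ]
      exact even_two.mul_left _
  have hsA : s ∈ alternatingGroup α := by
    rw [mem_alternatingGroup, hsign, heven.neg_one_pow]
  have hsQ : s ∈ Q := Subgroup.mem_of_commute_of_card_maximal hQA hQ hQmax hsA (k := 1)
    (by simpa using hs2) fun q hq => (hcomm q (hx q hq).symm (hinv q hq)).symm
  refine hxa ?_
  rw [← hsx a ((hmem a).2 ⟨1, Q.one_mem, rfl⟩)]
  exact ⟨⟨s, hsQ⟩, rfl⟩

/-- A permutation that commutes with a finite group `Q` and preserves each orbit of `Q` is killed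
by the order of `Q`. -/
theorem Equiv.Perm.pow_card_eq_one_of_commute {α : Type*} {Q : Subgroup (Perm α)}
    {x : Perm α} (hx : ∀ q ∈ Q, Commute x q) (horb : ∀ a, x a ∈ MulAction.orbit Q a) :
    x ^ Nat.card Q = 1 := by
  ext a
  obtain ⟨⟨q, hq⟩, hqa : q a = x a⟩ := horb a
  have hpow : ∀ k : ℕ, (x ^ k) a = (q ^ k) a := by
    intro k
    induction k with
    | zero => rfl
    | succ k ih =>
      have hc : (x ^ k) (q a) = q ((x ^ k) a) :=
        congrArg (fun g : Perm α => g a) ((hx q hq).pow_left k)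
      rw [pow_succ, Perm.mul_apply, ← hqa, hc, ih, pow_succ', Perm.mul_apply]
  have hq1 : q ^ Nat.card Q = 1 :=
    congrArg Subtype.val (pow_card_eq_one' (x := (⟨q, hq⟩ : Q)))
  rw [hpow, hq1]

/-- An even permutation centralizing a Sylow `2`-subgroup of the alternating group on an even
number of points lies in that subgroup. -/
theorem alternatingGroup.mem_sylow_two_of_commute {α : Type*} [Fintype α] [DecidableEq α]
    (heven : 2 ∣ Fintype.card α)
    {Q : Subgroup (Perm α)} (hQA : Q ≤ alternatingGroup α) (hQ : IsPGroup 2 Q)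
    (hQmax : ∀ R : Subgroup (Perm α), R ≤ alternatingGroup α → IsPGroup 2 R →
      Nat.card R ≤ Nat.card Q) {x : Perm α} (hxA : x ∈ alternatingGroup α)
    (hx : ∀ q ∈ Q, Commute x q) : x ∈ Q := by
  rcases le_or_gt (Fintype.card α) 2 with h2 | h3
  · rw [alternatingGroup.eq_bot_of_card_le_two (by rwa [Nat.card_eq_fintype_card]),
      Subgroup.mem_bot] at hxA
    exact hxA ▸ Q.one_mem
  · obtain ⟨k, hk⟩ := IsPGroup.iff_card.1 hQ
    exact Subgroup.mem_of_commute_of_card_maximal hQA hQ hQmax hxA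
      (hk ▸ pow_card_eq_one_of_commute hx
        (apply_mem_orbit_of_commute_sylow_two h3 heven hQA hQ hQmax hx)) hx


/-- Let `n ≥ 2` with `n ≡ 2 (mod 4)` and let `Q` be a Sylow `2`-subgroup
of the alternating group `𝔄_n` (a `2`-subgroup of `𝔄_n` of maximal possible order). Then
`C_{𝔄_n}(Q) = Z(Q)`, and there is a transposition `τ ∈ 𝔖_n` commuting with every element
of `Q` such that `C_{𝔖_n}(Q)` is the internal direct product of `Z(Q)` and the subgroup
`⟨τ⟩` of order `2`; in particular `|C_{𝔖_n}(Q)| = 2·|Z(Q)|` and every element of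
`C_{𝔖_n}(Q)` has the form `z` or `z·τ` with `z ∈ Z(Q)`. Here
`C_{𝔄_n}(Q) = C_{𝔖_n}(Q) ⊓ 𝔄_n` and `Z(Q) = C_{𝔖_n}(Q) ⊓ Q`. -/
theorem centralizer_sylow_two_alternating_of_two_mod_four
    (n : ℕ) (hn2 : 2 ≤ n) (hmod : n % 4 = 2)
    (Q : Subgroup (Equiv.Perm (Fin n))) (hQA : Q ≤ alternatingGroup (Fin n))
    (hQ2 : IsPGroup 2 Q)
    (hQmax : ∀ R : Subgroup (Equiv.Perm (Fin n)), R ≤ alternatingGroup (Fin n) →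
      IsPGroup 2 R → Nat.card R ≤ Nat.card Q) :
    Subgroup.centralizer (Q : Set (Equiv.Perm (Fin n))) ⊓ alternatingGroup (Fin n)
        = Subgroup.centralizer (Q : Set (Equiv.Perm (Fin n))) ⊓ Q ∧
    ∃ τ : Equiv.Perm (Fin n), τ.IsSwap ∧ (∀ q ∈ Q, Commute τ q) ∧
      Nat.card (Subgroup.zpowers τ) = 2 ∧
      (Subgroup.centralizer (Q : Set (Equiv.Perm (Fin n))) ⊓ Q) ⊓ Subgroup.zpowers τ = ⊥ ∧
      (Subgroup.centralizer (Q : Set (Equiv.Perm (Fin n))) ⊓ Q) ⊔ Subgroup.zpowers τ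
        = Subgroup.centralizer (Q : Set (Equiv.Perm (Fin n))) ∧
      Nat.card (Subgroup.centralizer (Q : Set (Equiv.Perm (Fin n))))
        = 2 * Nat.card (Subgroup.centralizer (Q : Set (Equiv.Perm (Fin n))) ⊓ Q :
            Subgroup (Equiv.Perm (Fin n))) ∧
      ∀ x ∈ Subgroup.centralizer (Q : Set (Equiv.Perm (Fin n))),
        ∃ z ∈ Subgroup.centralizer (Q : Set (Equiv.Perm (Fin n))) ⊓ Q,
          x = z ∨ x = z * τ := by
  set C := Subgroup.centralizer (Q : Set (Equiv.Perm (Fin n))) with hC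
  have hcomm : ∀ {x}, x ∈ C ↔ ∀ q ∈ Q, Commute x q := by
    intro x
    rw [hC, Subgroup.mem_centralizer_iff]
    exact forall₂_congr fun q _ => eq_comm
  have hCA : C ⊓ alternatingGroup (Fin n) = C ⊓ Q := by
    refine le_antisymm (fun x hx => ⟨hx.1, ?_⟩) (inf_le_inf_left _ hQA)
    exact alternatingGroup.mem_sylow_two_of_commute (by rw [Fintype.card_fin]; omega)
      hQA hQ2 hQmax hx.2 (hcomm.1 hx.1)
  obtain ⟨τ, hτ, hτQ⟩ := hQ2.exists_isSwap_commute (by rwa [Fintype.card_fin])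
  have hτC : τ ∈ C := hcomm.2 hτQ
  have hsign : sign τ = -1 := hτ.sign_eq
  have hsq : τ * τ = 1 := by
    obtain ⟨a, b, -, rfl⟩ := hτ
    exact swap_mul_self a b
  have hτA : τ ∉ alternatingGroup (Fin n) := by
    rw [mem_alternatingGroup, hsign]
    decide
  have hdecomp : ∀ x ∈ C, x * τ ∈ C ⊓ Q ∨ x ∈ C ⊓ Q := by
    intro x hx
    rw [← hCA]
    rcases Int.units_eq_one_or (sign x) with h | h
    · exact Or.inr ⟨hx, mem_alternatingGroup.2 h⟩
    · exact Or.inl ⟨mul_mem hx hτC, mem_alternatingGroup.2 (by rw [Perm.sign_mul, h, hsign]; rfl)⟩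
  have hexists : ∀ x ∈ C, ∃ z ∈ C ⊓ Q, x = z ∨ x = z * τ := by
    intro x hx
    rcases hdecomp x hx with h | h
    · exact ⟨x * τ, h, Or.inr (by rw [mul_assoc, hsq, mul_one])⟩
    · exact ⟨x, h, Or.inl rfl⟩
  refine ⟨hCA, τ, hτ, hτQ, ?_, ?_, ?_, ?_, hexists⟩
  · rw [Nat.card_zpowers, hτ.orderOf]
  · rw [eq_bot_iff]
    rintro x ⟨hxZ, hxτ⟩
    change x ∈ Subgroup.zpowers τ at hxτ
    rw [mem_zpowers_iff_mem_range_orderOf, hτ.orderOf] at hxτ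
    obtain rfl | rfl : x = 1 ∨ x = τ := by
      simpa [Finset.range_add_one, eq_comm, or_comm] using hxτ
    · exact Subgroup.mem_bot.2 rfl
    · exact absurd (hQA hxZ.2) hτA
  · refine le_antisymm (sup_le inf_le_left (Subgroup.zpowers_le.2 hτC)) fun x hx => ?_
    obtain ⟨z, hz, rfl | rfl⟩ := hexists x hx
    · exact Subgroup.mem_sup_left hz
    · exact Subgroup.mul_mem_sup hz (Subgroup.mem_zpowers τ)
  · have hindex : (C ⊓ Q).relIndex C = 2 :=
      Subgroup.relIndex_eq_two_iff_exists_notMem_and.2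
        ⟨τ, hτC, fun h => hτA (hQA h.2), hdecomp⟩
    rw [← hindex, mul_comm, ← Subgroup.relIndex_bot_left, ← Subgroup.relIndex_bot_left,
      Subgroup.relIndex_mul_relIndex _ _ _ bot_le inf_le_left]
end

section
/- Let Ω be a finite set and let Q ≤ Alt(Ω) be a 2-subgroup of the alternating group on Ω that acts fixed point freely on Ω and satisfies C_{Alt(Ω)}(Q) = Z(Q). Then the orbits of Q on Ω are pairwise non-isomorphic as Q-sets: for any two distinct Q-orbits Ω' and Ω'' on Ω there is no bijection f : Ω' → Ω'' satisfying f(q·x) = q·f(x) for all q ∈ Q and x ∈ Ω'. -/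
/-- The orbit of the point `ω` under a subgroup `Q` of the permutation group of `Ω`. -/
def permOrbit {Ω : Type*} (Q : Subgroup (Equiv.Perm Ω)) (ω : Ω) : Set Ω :=
  {x | ∃ q ∈ Q, q ω = x}

open Equiv.Perm in
/-- An involution moving a multiple of four points is even. -/
theorem Equiv.Perm.sign_eq_one_of_four_dvd_card_support {α : Type*} [Fintype α] [DecidableEq α]
    {σ : Equiv.Perm α} (hσ : σ ^ 2 = 1) (h4 : 4 ∣ σ.support.card) : sign σ = 1 := by
  have hc := cycleType_of_pow_prime_eq_one hσ
  have hs := σ.sum_cycleType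
  rw [hc, Multiset.sum_replicate, smul_eq_mul] at hs
  rw [sign_of_cycleType, sum_cycleType]
  exact Even.neg_one_pow (by rw [Nat.even_iff]; lia)

section SwapSets

variable {α : Type*} {A B : Set α}

open Classical in
/-- The map exchanging `A` and `B` along `f`, and fixing every other point. -/
noncomputable def swapSetsFun (f : A ≃ B) (x : α) : α :=
  if hA : x ∈ A then f ⟨x, hA⟩ else if hB : x ∈ B then f.symm ⟨x, hB⟩ else x

theorem swapSetsFun_left (f : A ≃ B) (x : A) : swapSetsFun f x = f x := by
  simp [swapSetsFun]

theorem swapSetsFun_right (hAB : Disjoint A B) (f : A ≃ B) (x : B) :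
    swapSetsFun f x = f.symm x := by
  simp [swapSetsFun, hAB.notMem_of_mem_right x.2]

theorem swapSetsFun_of_notMem (f : A ≃ B) {x : α} (hA : x ∉ A) (hB : x ∉ B) :
    swapSetsFun f x = x := by
  simp [swapSetsFun, hA, hB]

theorem swapSetsFun_involutive (hAB : Disjoint A B) (f : A ≃ B) :
    Function.Involutive (swapSetsFun f) := by
  intro x
  by_cases hA : x ∈ A
  · lift x to A using hA
    rw [swapSetsFun_left, swapSetsFun_right hAB, Equiv.symm_apply_apply]
  by_cases hB : x ∈ B
  · lift x to B using hB
    rw [swapSetsFun_right hAB, swapSetsFun_left, Equiv.apply_symm_apply]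
  · rw [swapSetsFun_of_notMem f hA hB, swapSetsFun_of_notMem f hA hB]

theorem swapSetsFun_ne_self_iff (hAB : Disjoint A B) (f : A ≃ B) (x : α) :
    swapSetsFun f x ≠ x ↔ x ∈ A ∪ B := by
  by_cases hA : x ∈ A
  · lift x to A using hA
    rw [swapSetsFun_left]
    exact iff_of_true (hAB.symm.ne_of_mem (f x).2 x.2) (Or.inl x.2)
  by_cases hB : x ∈ B
  · lift x to B using hB
    rw [swapSetsFun_right hAB]
    exact iff_of_true (hAB.ne_of_mem (f.symm x).2 x.2) (Or.inr x.2)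
  · simp [swapSetsFun_of_notMem f hA hB, hA, hB]

theorem sign_swapSets [Fintype α] [DecidableEq α] (hAB : Disjoint A B) (f : A ≃ B)
    (hA : Even A.ncard) : Equiv.Perm.sign (swapSetsFun_involutive hAB f).toPerm = 1 := by
  apply Equiv.Perm.sign_eq_one_of_four_dvd_card_support
  · ext x
    exact swapSetsFun_involutive hAB f x
  · have hs : ((swapSetsFun_involutive hAB f).toPerm.support : Set α) = A ∪ B := by
      ext x
      rw [Finset.mem_coe, Equiv.Perm.mem_support]
      exact swapSetsFun_ne_self_iff hAB f x
    rw [← Set.ncard_coe_finset, hs, Set.ncard_union_eq hAB,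
      ← Nat.card_coe_set_eq B, ← Nat.card_congr f, Nat.card_coe_set_eq]
    obtain ⟨k, hk⟩ := hA
    exact ⟨k, by lia⟩

/-- `swapSetsFun f` commutes with every permutation that preserves `A` and `B` and
commutes with `f`. -/
theorem swapSetsFun_apply_perm (hAB : Disjoint A B) (f : A ≃ B) {q : Equiv.Perm α}
    (hqA : ∀ x, q x ∈ A ↔ x ∈ A) (hqB : ∀ x, q x ∈ B ↔ x ∈ B)
    (hf : ∀ x y : A, (y : α) = q x → (f y : α) = q (f x)) (x : α) :
    swapSetsFun f (q x) = q (swapSetsFun f x) := by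
  by_cases hA : x ∈ A
  · lift x to A using hA
    rw [swapSetsFun_left, ← hf x ⟨q x, (hqA x).2 x.2⟩ rfl, ← swapSetsFun_left]
  by_cases hB : x ∈ B
  · lift x to B using hB
    have h := hf (f.symm x) ⟨q (f.symm x), (hqA _).2 (f.symm x).2⟩ rfl
    rw [Equiv.apply_symm_apply] at h
    rw [← h, swapSetsFun_right hAB, swapSetsFun_right hAB, Equiv.symm_apply_apply]
  · rw [swapSetsFun_of_notMem f hA hB,
      swapSetsFun_of_notMem f (mt (hqA x).1 hA) (mt (hqB x).1 hB)]

end SwapSets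

section PermOrbit

variable {Ω : Type*} (Q : Subgroup (Equiv.Perm Ω))

theorem permOrbit_eq_orbit (ω : Ω) : permOrbit Q ω = MulAction.orbit Q ω := by
  ext x
  simp [permOrbit, MulAction.mem_orbit_iff, Subgroup.smul_def]

theorem apply_mem_permOrbit_iff {q : Equiv.Perm Ω} (hq : q ∈ Q) (ω x : Ω) :
    q x ∈ permOrbit Q ω ↔ x ∈ permOrbit Q ω := by
  rw [permOrbit_eq_orbit]
  rw [← MulAction.orbit_eq_iff, ← MulAction.orbit_eq_iff]
  exact Eq.congr_left (MulAction.orbit_smul (⟨q, hq⟩ : Q) x)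

theorem mem_permOrbit_self (ω : Ω) : ω ∈ permOrbit Q ω := ⟨1, Q.one_mem, rfl⟩

theorem disjoint_permOrbit {ω₁ ω₂ : Ω} (h : permOrbit Q ω₁ ≠ permOrbit Q ω₂) :
    Disjoint (permOrbit Q ω₁) (permOrbit Q ω₂) := by
  simp only [permOrbit_eq_orbit] at h ⊢
  exact (MulAction.orbit.eq_or_disjoint ω₁ ω₂).resolve_left h

theorem even_ncard_permOrbit [Finite Ω] (hQ : IsPGroup 2 Q) {ω : Ω} (h : ∃ q ∈ Q, q ω ≠ ω) :
    Even (permOrbit Q ω).ncard := by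
  obtain ⟨n, hn⟩ := hQ.card_orbit ω
  rw [Nat.card_coe_set_eq, ← permOrbit_eq_orbit] at hn
  obtain ⟨q, hq, hne⟩ := h
  have hlt : 1 < (permOrbit Q ω).ncard :=
    (Set.one_lt_ncard).2 ⟨q ω, ⟨q, hq, rfl⟩, ω, mem_permOrbit_self Q ω, hne⟩
  have hn0 : n ≠ 0 := by
    rintro rfl
    lia
  rw [hn]
  exact even_two.pow_of_ne_zero hn0

end PermOrbit

/-- Let `Ω` be a finite set and let `Q ≤ Alt(Ω)` be a `2`-subgroup of the
alternating group on `Ω` acting fixed point freely on `Ω` and satisfying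
`C_{Alt(Ω)}(Q) = Z(Q)`. Then the orbits of `Q` on `Ω` are pairwise non-isomorphic as
`Q`-sets: for distinct `Q`-orbits `Ω'`, `Ω''` there is no `Q`-equivariant bijection
`Ω' → Ω''`. -/
theorem orbits_pairwise_nonisomorphic
    (Ω : Type*) [Fintype Ω] [DecidableEq Ω]
    (Q : Subgroup (Equiv.Perm Ω)) (hQA : Q ≤ alternatingGroup Ω)
    (hQ2 : IsPGroup 2 Q)
    (hfpf : ∀ ω : Ω, ∃ q ∈ Q, q ω ≠ ω)
    (hsc : Subgroup.centralizer (Q : Set (Equiv.Perm Ω)) ⊓ alternatingGroup Ω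
      = Subgroup.centralizer (Q : Set (Equiv.Perm Ω)) ⊓ Q) :
    ∀ ω₁ ω₂ : Ω, permOrbit Q ω₁ ≠ permOrbit Q ω₂ →
      ¬ ∃ f : ↥(permOrbit Q ω₁) ≃ ↥(permOrbit Q ω₂),
        ∀ q ∈ Q, ∀ (x y : ↥(permOrbit Q ω₁)), (y : Ω) = q (x : Ω) →
          ((f y : Ω) = q ((f x : Ω))) := by
  rintro ω₁ ω₂ hne ⟨f, hf⟩
  have hd := disjoint_permOrbit Q hne
  let τ : Equiv.Perm Ω := (swapSetsFun_involutive hd f).toPerm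
  have hτc : τ ∈ Subgroup.centralizer (Q : Set (Equiv.Perm Ω)) := by
    rw [Subgroup.mem_centralizer_iff]
    intro q hq
    ext x
    exact (swapSetsFun_apply_perm hd f (apply_mem_permOrbit_iff Q hq ω₁)
      (apply_mem_permOrbit_iff Q hq ω₂) (hf q hq) x).symm
  have hτA : τ ∈ alternatingGroup Ω :=
    Equiv.Perm.mem_alternatingGroup.2 (sign_swapSets hd f (even_ncard_permOrbit Q hQ2 (hfpf ω₁)))
  have hτQ : τ ∈ Q := (hsc.le ⟨hτc, hτA⟩).2
  have hω₁ := mem_permOrbit_self Q ω₁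
  have hτω : τ ω₁ = f ⟨ω₁, hω₁⟩ := swapSetsFun_left f ⟨ω₁, hω₁⟩
  exact hd.ne_of_mem ((apply_mem_permOrbit_iff Q hτQ ω₁ ω₁).2 hω₁) (f ⟨ω₁, hω₁⟩).2 hτω
end

section
/- Let Ω be a finite set and let Q ≤ Alt(Ω) be a 2-subgroup of the alternating group on Ω that acts fixed point freely on Ω and satisfies C_{Alt(Ω)}(Q) = Z(Q). Then exactly one of the following holds: (i) |Ω| ≤ |Q|; or (ii) |Ω| = |Q| + 2, the group Q is cyclic of order at least 4, and Q has exactly two orbits on Ω, of lengths |Q| and 2; or (iii) |Ω| = 6, the group Q is a Klein four-group (isomorphic to C_2 × C_2, so |Q| = 4), and Q has exactly three orbits on Ω, each of length 2. -/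
section Cases

variable {Ω : Type*} [Fintype Ω] [DecidableEq Ω] (Q : Subgroup (Equiv.Perm Ω))

/-- Case (i): `|Ω| ≤ |Q|`. -/
def CaseSmall : Prop := Nat.card Ω ≤ Nat.card Q

/-- Case (ii): `|Ω| = |Q| + 2`, `Q` is cyclic of order at least `4`, and `Q` has exactly
two orbits on `Ω`, of lengths `|Q|` and `2`. -/
def CaseCyclic : Prop :=
  Nat.card Ω = Nat.card Q + 2 ∧ IsCyclic Q ∧ 4 ≤ Nat.card Q ∧
    ∃ ω₁ ω₂ : Ω, permOrbit Q ω₁ ≠ permOrbit Q ω₂ ∧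
      (∀ ω : Ω, permOrbit Q ω = permOrbit Q ω₁ ∨ permOrbit Q ω = permOrbit Q ω₂) ∧
      Nat.card (permOrbit Q ω₁) = Nat.card Q ∧ Nat.card (permOrbit Q ω₂) = 2

/-- Case (iii): `|Ω| = 6`, `Q` is a Klein four-group (isomorphic to `C₂ × C₂`, so
`|Q| = 4`), and `Q` has exactly three orbits on `Ω`, each of length `2`. -/
def CaseKlein : Prop :=
  Nat.card Ω = 6 ∧ Nonempty (Q ≃* Multiplicative (ZMod 2 × ZMod 2)) ∧ Nat.card Q = 4 ∧
    ∃ ω₁ ω₂ ω₃ : Ω, permOrbit Q ω₁ ≠ permOrbit Q ω₂ ∧ permOrbit Q ω₁ ≠ permOrbit Q ω₃ ∧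
      permOrbit Q ω₂ ≠ permOrbit Q ω₃ ∧
      (∀ ω : Ω, permOrbit Q ω = permOrbit Q ω₁ ∨ permOrbit Q ω = permOrbit Q ω₂ ∨
        permOrbit Q ω = permOrbit Q ω₃) ∧
      Nat.card (permOrbit Q ω₁) = 2 ∧ Nat.card (permOrbit Q ω₂) = 2 ∧
      Nat.card (permOrbit Q ω₃) = 2

end Cases

open Equiv.Perm in
/-- The permutation agreeing with `σ` on the fibers of `π` over `S`, and trivial elsewhere. -/
def Equiv.Perm.restrictFibers {Ω α : Type*} [DecidableEq α] (π : Ω → α) (σ : Equiv.Perm Ω)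
    (h : ∀ x, π (σ x) = π x) (S : Finset α) : Equiv.Perm Ω :=
  ofSubtype (σ.subtypePerm (p := fun x => π x ∈ S) (fun x => by rw [h x]))

namespace SelfCentralizing

open Equiv Equiv.Perm

section Restrict

variable {Ω α : Type*} [DecidableEq α] {π : Ω → α} {σ : Perm Ω}

theorem restrictFibers_apply (h : ∀ x, π (σ x) = π x) (S : Finset α) (x : Ω) :
    σ.restrictFibers π h S x = if π x ∈ S then σ x else x := by
  unfold restrictFibers
  split_ifs with hx
  · exact ofSubtype_subtypePerm_of_mem _ hx
  · exact ofSubtype_subtypePerm_of_not_mem _ hx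

theorem restrictFibers_insert (h : ∀ x, π (σ x) = π x) {i : α} {S : Finset α} (hi : i ∉ S) :
    σ.restrictFibers π h (insert i S) = σ.restrictFibers π h {i} * σ.restrictFibers π h S := by
  ext x
  rw [Perm.mul_apply, restrictFibers_apply, restrictFibers_apply, restrictFibers_apply]
  by_cases h1 : π x = i <;> by_cases h2 : π x ∈ S <;> simp_all

theorem restrictFibers_pow_apply (h : ∀ x, π (σ x) = π x) {S : Finset α} {x : Ω}
    (hx : π x ∈ S) (n : ℕ) : (σ.restrictFibers π h S ^ n) x = (σ ^ n) x := by
  induction n with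
  | zero => rfl
  | succ n ih =>
    have hπ : ∀ n : ℕ, π ((σ ^ n) x) = π x := by
      intro n
      induction n with
      | zero => rfl
      | succ n ih => rw [pow_succ', Perm.mul_apply, h, ih]
    rw [pow_succ', pow_succ', Perm.mul_apply, Perm.mul_apply, ih, restrictFibers_apply, hπ,
      if_pos hx]

theorem restrictFibers_pow_apply_of_notMem (h : ∀ x, π (σ x) = π x) {S : Finset α} {x : Ω}
    (hx : π x ∉ S) (n : ℕ) : (σ.restrictFibers π h S ^ n) x = x := by
  induction n with
  | zero => rfl
  | succ n ih => rw [pow_succ', Perm.mul_apply, ih, restrictFibers_apply, if_neg hx]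

theorem restrictFibers_commute (h : ∀ x, π (σ x) = π x) {S : Finset α} {q : Perm Ω}
    (hq : ∀ x, π (q x) = π x) (hc : ∀ x, π x ∈ S → q (σ x) = σ (q x)) :
    q * σ.restrictFibers π h S = σ.restrictFibers π h S * q := by
  ext x
  rw [Perm.mul_apply, Perm.mul_apply, restrictFibers_apply, restrictFibers_apply, hq]
  split_ifs with hx
  · exact hc x hx
  · rfl

variable [Fintype Ω] [DecidableEq Ω]

theorem sign_restrictFibers (h : ∀ x, π (σ x) = π x) (S : Finset α) :
    sign (σ.restrictFibers π h S) = ∏ i ∈ S, sign (σ.restrictFibers π h {i}) := by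
  induction S using Finset.induction_on with
  | empty =>
    have : σ.restrictFibers π h ∅ = 1 := by
      ext x
      simp [restrictFibers_apply]
    simp [this]
  | insert i S hi ih => rw [restrictFibers_insert h hi, map_mul, ih, Finset.prod_insert hi]

theorem sign_eq_prod_restrictFibers [Fintype α] (h : ∀ x, π (σ x) = π x) :
    sign σ = ∏ i, sign (σ.restrictFibers π h {i}) := by
  rw [← sign_restrictFibers]
  congr 1
  ext x
  simp [restrictFibers_apply]

theorem support_restrictFibers (h : ∀ x, π (σ x) = π x) {S : Finset α}
    (hσ : ∀ x, π x ∈ S → σ x ≠ x) :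
    (σ.restrictFibers π h S).support = Finset.univ.filter (fun x => π x ∈ S) := by
  ext x
  simp only [mem_support, restrictFibers_apply, Finset.mem_filter, Finset.mem_univ, true_and]
  by_cases hx : π x ∈ S <;> simp [hx, hσ]

theorem sign_of_involution {τ : Perm Ω} (hτ : ∀ x, τ (τ x) = x) :
    sign τ = (-1) ^ (τ.support.card / 2) := by
  have h2 : τ ^ 2 = 1 := by
    ext x
    simp [pow_two, hτ]
  rw [sign_of_cycleType_eq_replicate two_pos (cycleType_of_pow_prime_eq_one h2),
    if_neg (by decide), card_fixedPoints, Nat.sub_sub_self, sum_cycleType]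
  rw [sum_cycleType]
  exact Finset.card_le_univ _

/-- A semiregular odd permutation whose support has `2`-power size is a full cycle. -/
theorem orderOf_eq_card_support_of_semiregular {u : Perm Ω} {a : ℕ}
    (ha : u.support.card = 2 ^ a) (hodd : sign u = -1)
    (hs : ∀ (n : ℕ) (x : Ω), u x ≠ x → (u ^ n) x = x → u ^ n = 1) :
    orderOf u = u.support.card ∧ u.IsCycle := by
  have hrep : u.cycleType = Multiset.replicate u.cycleType.card (orderOf u) := by
    refine Multiset.eq_replicate.mpr ⟨rfl, fun n hn => ?_⟩
    refine Nat.dvd_antisymm (dvd_of_mem_cycleType hn) ?_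
    rw [cycleType_def, Multiset.mem_map] at hn
    obtain ⟨c, hc, rfl⟩ := hn
    have hc' : c ∈ u.cycleFactorsFinset := hc
    have hcyc := (mem_cycleFactorsFinset_iff.mp hc').1
    obtain ⟨x, hx⟩ := hcyc.nonempty_support
    have hcu : c = u.cycleOf x := cycle_is_cycleOf hx hc'
    refine orderOf_dvd_of_pow_eq_one (hs _ x ?_ ?_)
    · exact mem_support.mp (mem_cycleFactorsFinset_support_le hc' hx)
    · rw [← cycleOf_pow_apply_self, ← hcu, Function.comp_apply, ← hcyc.orderOf, pow_orderOf_eq_one,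
        Perm.one_apply]
  have hsum : u.cycleType.card * orderOf u = 2 ^ a := by
    rw [← ha, ← sum_cycleType]
    conv_rhs => rw [hrep]
    simp
  have hcard : u.cycleType.card = 1 := by
    obtain ⟨b, -, hb⟩ := (Nat.dvd_prime_pow Nat.prime_two).mp (Dvd.intro _ hsum)
    rcases Nat.eq_zero_or_pos b with rfl | hb0
    · simpa using hb
    · exfalso
      have h1 : Even (2 ^ a) := by
        rw [← hsum, hb]
        exact ((Nat.even_pow.mpr ⟨even_two, hb0.ne'⟩)).mul_right _
      have h2 : Even u.cycleType.card := by
        rw [hb]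
        exact Nat.even_pow.mpr ⟨even_two, hb0.ne'⟩
      rw [sign_of_cycleType, sum_cycleType, ha, (h1.add h2).neg_one_pow] at hodd
      exact absurd hodd (by decide)
  refine ⟨?_, card_cycleType_eq_one.mp hcard⟩
  rw [ha, ← hsum, hcard, one_mul]

end Restrict

section Involution

/-- A `2`-group acting without fixed points has, at each point, an element normalizing the
stabilizer and moving the point as an involution. -/
theorem exists_normalizing_involution {Ω : Type*} [Finite Ω] {Q : Subgroup (Perm Ω)}
    (hQ2 : IsPGroup 2 Q) (ω : Ω) (hω : ∃ q ∈ Q, q ω ≠ ω) :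
    ∃ n ∈ Q, n ω ≠ ω ∧ n (n ω) = ω ∧ ∀ h ∈ Q, h ω = ω → h (n ω) = n ω := by
  have : Fact (Nat.Prime 2) := ⟨Nat.prime_two⟩
  obtain ⟨a, ha⟩ := IsPGroup.iff_card.mp hQ2
  let H : Subgroup Q := MulAction.stabilizer Q ω
  obtain ⟨b, hb⟩ := IsPGroup.iff_card.mp (hQ2.to_subgroup H)
  have hba : 2 ^ (b + 1) ∣ Nat.card Q := by
    rw [ha]
    refine pow_dvd_pow 2 ?_
    have hle : 2 ^ b ∣ 2 ^ a := by
      rw [← ha, ← hb]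
      exact H.card_subgroup_dvd_card
    have hle' := (Nat.pow_dvd_pow_iff_le_right (by norm_num)).mp hle
    rcases hle'.lt_or_eq with hlt | heq
    · exact hlt
    · exfalso
      obtain ⟨q, hq, hqω⟩ := hω
      have htop : H = ⊤ := Subgroup.eq_top_of_card_eq _ (by rw [hb, ha, heq])
      have : (⟨q, hq⟩ : Q) ∈ H := htop ▸ Subgroup.mem_top _
      exact hqω this
  obtain ⟨K, hK, hHK⟩ := Sylow.exists_subgroup_card_pow_succ hba hb
  have hidx : (H.subgroupOf K).index = 2 := by
    have h1 := (H.subgroupOf K).card_mul_index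
    rw [Nat.card_congr (Subgroup.subgroupOfEquivOfLe hHK).toEquiv, hb, hK, pow_succ] at h1
    exact Nat.eq_of_mul_eq_mul_left (by positivity) h1
  obtain ⟨n, hn⟩ : ∃ n : K, n ∉ H.subgroupOf K := by
    by_contra! hcon
    rw [(Subgroup.eq_top_iff' _).mpr hcon, Subgroup.index_top] at hidx
    omega
  have hmem : ∀ k : K, k ∈ H.subgroupOf K ↔ (k : Q).1 ω = ω := fun k => Iff.rfl
  refine ⟨n.1.1, n.1.2, hn, ?_, fun h hh hhω => ?_⟩
  · exact (hmem _).mp (Subgroup.mul_self_mem_of_index_two hidx n)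
  · have hN := Subgroup.normal_of_index_eq_two hidx
    have hk : (⟨⟨h, hh⟩, hHK hhω⟩ : K) ∈ H.subgroupOf K := hhω
    have := (hmem _).mp (hN.conj_mem' _ hk n)
    have h2 : n.1.1⁻¹ (h (n.1.1 ω)) = ω := this
    rwa [Perm.inv_eq_iff_eq] at h2

/-- A fixed-point-free involution centralizing `Q` and preserving each orbit. -/
theorem exists_central_involution {Ω : Type*} [Finite Ω] {Q : Subgroup (Perm Ω)}
    (hQ2 : IsPGroup 2 Q) (hfpf : ∀ ω, ∃ q ∈ Q, q ω ≠ ω) :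
    ∃ t : Perm Ω, (∀ x, t x ≠ x) ∧ (∀ x, t (t x) = x) ∧ (∀ x, ∃ q ∈ Q, q x = t x) ∧
      ∀ q ∈ Q, ∀ x, q (t x) = t (q x) := by
  choose n hnQ hn1 hn2 hn3 using fun ω => exists_normalizing_involution hQ2 ω (hfpf ω)
  let s := MulAction.orbitRel Q Ω
  let r : Ω → Ω := fun x => (Quotient.mk s x).out
  have hr : ∀ x, ∃ q : Q, q.1 (r x) = x := fun x => by
    have h : s (r x) x := Quotient.exact (Quotient.out_eq _)
    exact MulAction.mem_orbit_iff.mp (s.symm h)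
  have hrq : ∀ (q : Q) x, r (q.1 x) = r x := fun q x => by
    have : Quotient.mk s (q.1 x) = Quotient.mk s x := Quotient.sound ⟨q, rfl⟩
    simp only [r, this]
  choose p hp using hr
  let f : Ω → Ω := fun x => (p x).1 (n (r x) (r x))
  have hf : ∀ (q : Q) x, q.1 (r x) = x → f x = q.1 (n (r x) (r x)) := fun q x hq => by
    have h1 := hn3 (r x) (q⁻¹ * p x).1 (q⁻¹ * p x).2 (by
      change q.1⁻¹ ((p x).1 (r x)) = r x
      rw [hp, Perm.inv_eq_iff_eq, hq])
    change q.1⁻¹ ((p x).1 _) = _ at h1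
    rwa [Perm.inv_eq_iff_eq] at h1
  have hrf : ∀ x, r (f x) = r x := fun x => by
    have := hrq (p x * ⟨n (r x), hnQ _⟩ * (p x)⁻¹) x
    have e : (p x * ⟨n (r x), hnQ _⟩ * (p x)⁻¹).1 x = f x := by
      change (p x).1 (n (r x) ((p x).1⁻¹ x)) = _
      rw [Perm.inv_eq_iff_eq.mpr (hp x).symm]
    rwa [e] at this
  have hff : ∀ x, f (f x) = x := fun x => by
    rw [hf (p x * ⟨n (r x), hnQ _⟩) (f x) (by rw [hrf]; rfl), hrf]
    change (p x).1 (n (r x) (n (r x) (r x))) = x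
    rw [hn2, hp]
  refine ⟨⟨f, f, hff, hff⟩, fun x hx => ?_, hff, fun x => ?_, fun q hq x => ?_⟩
  · refine hn1 (r x) ((p x).1.injective ?_)
    rw [hp]
    exact hx
  · refine ⟨(p x * ⟨n (r x), hnQ _⟩ * (p x)⁻¹).1, Subtype.coe_prop _, ?_⟩
    change (p x).1 (n (r x) ((p x).1⁻¹ x)) = (p x).1 (n (r x) (r x))
    rw [Perm.inv_eq_iff_eq.mpr (hp x).symm]
  · change q (f x) = f (q x)
    have hrx := hrq ⟨q, hq⟩ x
    rw [hf (⟨q, hq⟩ * p x) (q x) (by rw [hrx]; exact congrArg q (hp x)), hrx]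
    rfl

end Involution

/-- `π` is the orbit map of the self-centralizing `2`-group `Q` of even permutations, and `t` is a
fixed-point-free involution centralizing `Q` and preserving each orbit. -/
structure OrbitInvolution {Ω α : Type*} [Fintype Ω] [DecidableEq Ω] (Q : Subgroup (Perm Ω))
    (π : Ω → α) (t : Perm Ω) : Prop where
  map_eq_iff : ∀ x y, π x = π y ↔ ∃ q ∈ Q, q x = y
  surjective : Function.Surjective π
  isPGroup : IsPGroup 2 Q
  sign_eq_one : ∀ q ∈ Q, sign q = 1
  mem_of_commute : ∀ u : Perm Ω, (∀ q ∈ Q, q * u = u * q) → sign u = 1 → u ∈ Q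
  map_apply : ∀ x, π (t x) = π x
  apply_ne : ∀ x, t x ≠ x
  apply_apply : ∀ x, t (t x) = x
  comm : ∀ q ∈ Q, ∀ x, q (t x) = t (q x)

/-- The size of the fiber of `π` over `i`. -/
def fiberCard {Ω α : Type*} [Fintype Ω] [DecidableEq α] (π : Ω → α) (i : α) : ℕ :=
  (Finset.univ.filter (fun x => π x = i)).card

theorem card_eq_sum_fiberCard {Ω α : Type*} [Fintype Ω] [Fintype α] [DecidableEq α] (π : Ω → α) :
    Nat.card Ω = ∑ i, fiberCard π i := by
  rw [Nat.card_eq_fintype_card, ← Finset.card_univ]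
  exact Finset.card_eq_sum_card_fiberwise (fun _ _ => Finset.mem_univ _)

namespace OrbitInvolution

variable {Ω α : Type*} [Fintype Ω] [DecidableEq Ω]
  {Q : Subgroup (Perm Ω)} {π : Ω → α} {t : Perm Ω}

theorem map_of_mem (D : OrbitInvolution Q π t) {q : Perm Ω} (hq : q ∈ Q) (x : Ω) :
    π (q x) = π x :=
  ((D.map_eq_iff _ _).mpr ⟨q, hq, rfl⟩).symm

theorem card_eq_two_pow (D : OrbitInvolution Q π t) : ∃ a, Nat.card Q = 2 ^ a := by
  have : Fact (Nat.Prime 2) := ⟨Nat.prime_two⟩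
  exact IsPGroup.iff_card.mp D.isPGroup

theorem exists_mem_apply_eq (D : OrbitInvolution Q π t) (x : Ω) : ∃ g ∈ Q, g x = t x :=
  (D.map_eq_iff _ _).mp (D.map_apply x).symm

variable [DecidableEq α]

theorem fiberCard_mul_card_stabilizer (D : OrbitInvolution Q π t) (x : Ω) :
    fiberCard π (π x) * Nat.card (Q ⊓ MulAction.stabilizer (Perm Ω) x : Subgroup (Perm Ω))
      = Nat.card Q := by
  have h1 := (MulAction.stabilizer Q x).index_mul_card
  rw [MulAction.index_stabilizer] at h1
  rw [← h1]
  congr 1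
  · rw [fiberCard, ← Set.ncard_coe_finset]
    congr 1
    ext y
    simp only [Finset.coe_filter, Finset.mem_univ, true_and, Set.mem_ofPred_eq]
    rw [eq_comm, D.map_eq_iff, MulAction.mem_orbit_iff]
    constructor
    · rintro ⟨q, hq, h⟩
      exact ⟨⟨q, hq⟩, h⟩
    · rintro ⟨q, h⟩
      exact ⟨q.1, q.2, h⟩
  · refine Nat.card_congr ⟨fun g => ⟨⟨g.1, g.2.1⟩, g.2.2⟩, fun g => ⟨g.1.1, g.1.2, g.2⟩, ?_, ?_⟩
    · intro g
      rfl
    · intro g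
      rfl

theorem fiberCard_dvd (D : OrbitInvolution Q π t) (i : α) : fiberCard π i ∣ Nat.card Q := by
  obtain ⟨x, rfl⟩ := D.surjective i
  exact Dvd.intro _ (D.fiberCard_mul_card_stabilizer x)

theorem two_le_fiberCard (D : OrbitInvolution Q π t) (i : α) : 2 ≤ fiberCard π i := by
  obtain ⟨x, rfl⟩ := D.surjective i
  exact Finset.one_lt_card.mpr ⟨x, by simp, t x, by simp [D.map_apply], (D.apply_ne x).symm⟩

theorem four_dvd_fiberCard (D : OrbitInvolution Q π t) {i : α} (hi : fiberCard π i ≠ 2) :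
    4 ∣ fiberCard π i := by
  obtain ⟨a, ha⟩ := D.card_eq_two_pow
  obtain ⟨b, -, hb⟩ := (Nat.dvd_prime_pow Nat.prime_two).mp (ha ▸ D.fiberCard_dvd i)
  have h2 := D.two_le_fiberCard i
  rw [hb] at hi h2 ⊢
  rcases b with _ | _ | b
  · norm_num at h2
  · norm_num at hi
  · exact ⟨2 ^ b, by ring⟩

theorem four_le_fiberCard (D : OrbitInvolution Q π t) {i : α} (hi : fiberCard π i ≠ 2) :
    4 ≤ fiberCard π i :=
  Nat.le_of_dvd (by have := D.two_le_fiberCard i; omega) (D.four_dvd_fiberCard hi)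

/-- The product of the restrictions of the central involution to the orbits in `S`. -/
def part (D : OrbitInvolution Q π t) (S : Finset α) : Perm Ω :=
  t.restrictFibers π D.map_apply S

theorem part_apply (D : OrbitInvolution Q π t) (S : Finset α) (x : Ω) :
    D.part S x = if π x ∈ S then t x else x :=
  restrictFibers_apply _ _ _

theorem part_injective (D : OrbitInvolution Q π t) : Function.Injective D.part := by
  intro S S' h
  ext i
  obtain ⟨x, rfl⟩ := D.surjective i
  have hx := congrArg (fun p : Perm Ω => p x) h
  simp only [part_apply] at hx
  have hne := D.apply_ne x
  by_cases h1 : π x ∈ S <;> by_cases h2 : π x ∈ S'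
  · exact iff_of_true h1 h2
  · rw [if_pos h1, if_neg h2] at hx
    exact absurd hx hne
  · rw [if_neg h1, if_pos h2] at hx
    exact absurd hx.symm hne
  · exact iff_of_false h1 h2

theorem part_commute (D : OrbitInvolution Q π t) (S : Finset α) {q : Perm Ω} (hq : q ∈ Q) :
    q * D.part S = D.part S * q :=
  restrictFibers_commute _ (D.map_of_mem hq) (fun x _ => D.comm q hq x)

theorem part_mem (D : OrbitInvolution Q π t) {S : Finset α} (hS : sign (D.part S) = 1) :
    D.part S ∈ Q :=
  D.mem_of_commute _ (fun _ hq => D.part_commute S hq) hS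

theorem sign_part (D : OrbitInvolution Q π t) (S : Finset α) :
    sign (D.part S) = ∏ i ∈ S, sign (D.part {i}) :=
  sign_restrictFibers _ _

theorem sign_part_singleton (D : OrbitInvolution Q π t) (i : α) :
    sign (D.part {i}) = (-1) ^ (fiberCard π i / 2) := by
  rw [sign_of_involution, part, support_restrictFibers _ (fun x _ => D.apply_ne x)]
  · simp [fiberCard]
  · intro x
    rw [part_apply, part_apply]
    by_cases hx : π x ∈ ({i} : Finset α)
    · rw [if_pos hx, D.map_apply, if_pos hx, D.apply_apply]
    · rw [if_neg hx, if_neg hx]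

theorem sign_part_of_eq_two (D : OrbitInvolution Q π t) {i : α} (hi : fiberCard π i = 2) :
    sign (D.part {i}) = -1 := by
  rw [sign_part_singleton, hi]
  decide

theorem sign_part_of_ne_two (D : OrbitInvolution Q π t) {i : α} (hi : fiberCard π i ≠ 2) :
    sign (D.part {i}) = 1 := by
  obtain ⟨c, hc⟩ := D.four_dvd_fiberCard hi
  rw [sign_part_singleton, hc, show 4 * c / 2 = 2 * c by omega, pow_mul]
  simp

theorem two_pow_le_card (D : OrbitInvolution Q π t) (H : Subgroup (Perm Ω)) (B : Finset α)
    (f : Finset α → Finset α) (hf : Set.InjOn f B.powerset)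
    (hH : ∀ S ⊆ B, D.part (f S) ∈ H) : 2 ^ B.card ≤ Nat.card H := by
  have hc : Nat.card (B.powerset : Set (Finset α)) = 2 ^ B.card := by
    rw [Nat.card_coe_set_eq, Set.ncard_coe_finset, Finset.card_powerset]
  rw [← hc]
  refine Nat.card_le_card_of_injective
    (fun S : (B.powerset : Set (Finset α)) =>
      (⟨D.part (f S.1), hH S.1 (Finset.mem_powerset.mp S.2)⟩ : H)) ?_
  intro S S' h
  exact Subtype.ext (hf S.2 S'.2 (D.part_injective (Subtype.ext_iff.mp h)))

theorem part_mem_stabilizer (D : OrbitInvolution Q π t) {S : Finset α} {x : Ω} (hx : π x ∉ S) :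
    D.part S ∈ MulAction.stabilizer (Perm Ω) x := by
  rw [MulAction.mem_stabilizer_iff, Perm.smul_def, part_apply, if_neg hx]

theorem exists_parity_fixer (D : OrbitInvolution Q π t) {s : α} (hs : fiberCard π s = 2)
    {B : Finset α} (hB : s ∉ B) :
    ∃ f : Finset α → Finset α, Set.InjOn f B.powerset ∧
      ∀ S ⊆ B, sign (D.part (f S)) = 1 ∧ f S ⊆ insert s B := by
  classical
  refine ⟨fun S => if sign (D.part S) = 1 then S else insert s S, ?_, ?_⟩
  · intro S hS S' hS' h
    have h1 : s ∉ S := fun h => hB (Finset.mem_powerset.mp hS h)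
    have h2 : s ∉ S' := fun h => hB (Finset.mem_powerset.mp hS' h)
    have key : ∀ S : Finset α, s ∉ S →
        (if sign (D.part S) = 1 then S else insert s S).erase s = S := by
      intro S hS
      split_ifs
      · exact Finset.erase_eq_of_notMem hS
      · exact Finset.erase_insert hS
    rw [← key S h1, ← key S' h2]
    exact congrArg (Finset.erase · s) h
  · intro S hS
    have h1 : s ∉ S := fun h => hB (hS h)
    dsimp only
    split_ifs with h
    · exact ⟨h, hS.trans (Finset.subset_insert _ _)⟩
    · refine ⟨?_, Finset.insert_subset_insert _ hS⟩
      have h' := (Int.units_eq_one_or _).resolve_left h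
      rw [sign_part, Finset.prod_insert h1, ← sign_part, h', D.sign_part_of_eq_two hs]
      decide

section Bounds

variable [Fintype α]

theorem fiberCard_mul_le_of_forall (D : OrbitInvolution Q π t) (h : ∀ i, fiberCard π i ≠ 2)
    (i : α) : fiberCard π i * 2 ^ (Fintype.card α - 1) ≤ Nat.card Q := by
  obtain ⟨x, rfl⟩ := D.surjective i
  rw [← D.fiberCard_mul_card_stabilizer x, ← Finset.card_univ,
    ← Finset.card_erase_of_mem (Finset.mem_univ (π x))]
  refine Nat.mul_le_mul_left _ (D.two_pow_le_card _ _ id (Set.injOn_id _) fun S hS => ?_)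
  refine ⟨D.part_mem ?_, D.part_mem_stabilizer fun hx => ?_⟩
  · rw [sign_part]
    exact Finset.prod_eq_one fun i _ => D.sign_part_of_ne_two (h i)
  · exact Finset.notMem_erase _ _ (hS hx)

theorem two_pow_le (D : OrbitInvolution Q π t) {s : α} (hs : fiberCard π s = 2) :
    2 ^ (Fintype.card α - 1) ≤ Nat.card Q := by
  rw [← Finset.card_univ, ← Finset.card_erase_of_mem (Finset.mem_univ s)]
  obtain ⟨f, hf, hf'⟩ := D.exists_parity_fixer hs (Finset.notMem_erase s Finset.univ)
  exact D.two_pow_le_card _ _ f hf fun S hS => D.part_mem (hf' S hS).1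

theorem fiberCard_mul_le (D : OrbitInvolution Q π t) {s : α} (hs : fiberCard π s = 2)
    {i : α} (hi : i ≠ s) : fiberCard π i * 2 ^ (Fintype.card α - 2) ≤ Nat.card Q := by
  obtain ⟨x, rfl⟩ := D.surjective i
  have hc : ((Finset.univ.erase s).erase (π x)).card = Fintype.card α - 2 := by
    rw [Finset.card_erase_of_mem (by simp [hi]), Finset.card_erase_of_mem (Finset.mem_univ _),
      Finset.card_univ]
    omega
  rw [← D.fiberCard_mul_card_stabilizer x, ← hc]
  obtain ⟨f, hf, hf'⟩ := D.exists_parity_fixer hs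
    (B := (Finset.univ.erase s).erase (π x)) (by simp)
  refine Nat.mul_le_mul_left _ (D.two_pow_le_card _ _ f hf fun S hS =>
    ⟨D.part_mem (hf' S hS).1, D.part_mem_stabilizer fun hx => ?_⟩)
  have := (hf' S hS).2 hx
  simp [hi] at this

end Bounds

section Structure

theorem sign_restrictFibers_of_apply_ne (D : OrbitInvolution Q π t) {g : Perm Ω} (hg : g ∈ Q)
    {x : Ω} (hx : fiberCard π (π x) = 2) (hgx : g x ≠ x) :
    sign (g.restrictFibers π (D.map_of_mem hg) {π x}) = -1 := by
  refine (card_support_eq_two.mp (le_antisymm ?_ (two_le_card_support_of_ne_one ?_))).sign_eq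
  · rw [← hx]
    refine Finset.card_le_card fun y hy => ?_
    rw [mem_support, restrictFibers_apply] at hy
    by_cases h : π y ∈ ({π x} : Finset α)
    · simpa using h
    · simp [h] at hy
  · intro h
    have := congrArg (fun p : Perm Ω => p x) h
    rw [restrictFibers_apply, if_pos (Finset.mem_singleton_self _)] at this
    exact hgx this

/-- If `Q` acts semiregularly on an orbit, then an element acting oddly there acts as a full
cycle. -/
theorem restrictFibers_isCycle (D : OrbitInvolution Q π t) {g : Perm Ω} (hg : g ∈ Q) {i : α}
    (hodd : sign (g.restrictFibers π (D.map_of_mem hg) {i}) = -1)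
    (hstab : ∀ y, π y = i → ∀ h ∈ Q, h y = y → ∀ z, π z = i → h z = z) :
    (∀ y, π y = i → g y ≠ y) ∧
    orderOf (g.restrictFibers π (D.map_of_mem hg) {i}) = fiberCard π i ∧
      (g.restrictFibers π (D.map_of_mem hg) {i}).IsCycle := by
  have key : ∀ (n : ℕ) (y : Ω), π y = i → (g ^ n) y = y →
      g.restrictFibers π (D.map_of_mem hg) {i} ^ n = 1 := by
    intro n y hy hn
    ext z
    by_cases hz : π z = i
    · rw [restrictFibers_pow_apply _ (by simp [hz]), Perm.one_apply]
      exact hstab y hy _ (Q.pow_mem hg n) hn z hz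
    · rw [restrictFibers_pow_apply_of_notMem _ (by simp [hz]), Perm.one_apply]
  have hne : ∀ y, π y = i → g y ≠ y := by
    intro y hy h
    have := key 1 y hy h
    rw [pow_one] at this
    rw [this, Perm.sign_one] at hodd
    exact absurd hodd (by decide)
  have hsupp : (g.restrictFibers π (D.map_of_mem hg) {i}).support.card = fiberCard π i := by
    rw [support_restrictFibers _ (fun x hx => hne x (by simpa using hx))]
    simp [fiberCard]
  obtain ⟨a, ha⟩ := D.card_eq_two_pow
  obtain ⟨b, -, hb⟩ := (Nat.dvd_prime_pow Nat.prime_two).mp (ha ▸ D.fiberCard_dvd i)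
  have := orderOf_eq_card_support_of_semiregular (hsupp.trans hb) hodd (by
    intro n x hx hn
    have hxi : π x = i := by
      by_contra h
      exact hx (by rw [restrictFibers_apply, if_neg (by simpa using h)])
    rw [restrictFibers_pow_apply _ (by simp [hxi])] at hn
    exact key n x hxi hn)
  exact ⟨hne, hsupp ▸ this.1, this.2⟩

theorem isCyclic_of_regular_orbit [Fintype α] (D : OrbitInvolution Q π t) {i s : α} (his : i ≠ s)
    (huniv : Finset.univ = {i, s}) (hs : fiberCard π s = 2) (hi : fiberCard π i = Nat.card Q) :
    IsCyclic Q := by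
  obtain ⟨x, rfl⟩ := D.surjective s
  obtain ⟨g, hg, hgx⟩ := D.exists_mem_apply_eq x
  have hsign := D.sign_eq_one g hg
  rw [sign_eq_prod_restrictFibers (D.map_of_mem hg), huniv, Finset.prod_pair his,
    D.sign_restrictFibers_of_apply_ne hg hs (hgx ▸ D.apply_ne x)] at hsign
  have hodd : sign (g.restrictFibers π (D.map_of_mem hg) {i}) = -1 := by
    simpa [neg_eq_iff_eq_neg] using hsign
  obtain ⟨-, hord, -⟩ := D.restrictFibers_isCycle hg hodd (by
    intro y hy h hh hhy z hz
    have h1 := D.fiberCard_mul_card_stabilizer y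
    rw [hy, hi] at h1
    have h2 : Nat.card (Q ⊓ MulAction.stabilizer (Perm Ω) y : Subgroup (Perm Ω)) = 1 :=
      Nat.eq_of_mul_eq_mul_left Nat.card_pos (h1.trans (mul_one _).symm)
    have h3 : h ∈ (Q ⊓ MulAction.stabilizer (Perm Ω) y : Subgroup (Perm Ω)) := ⟨hh, hhy⟩
    rw [Subgroup.eq_bot_of_card_eq _ h2, Subgroup.mem_bot] at h3
    rw [h3, Perm.one_apply])
  refine isCyclic_of_orderOf_eq_card (⟨g, hg⟩ : Q) ?_
  refine Nat.dvd_antisymm (orderOf_dvd_natCard _) ?_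
  rw [← hi, ← hord]
  refine orderOf_dvd_of_pow_eq_one ?_
  have hg1 : g ^ orderOf (⟨g, hg⟩ : Q) = 1 := by
    have := pow_orderOf_eq_one (⟨g, hg⟩ : Q)
    exact congrArg Subtype.val this
  ext z
  by_cases hz : π z = i
  · rw [restrictFibers_pow_apply _ (by simp [hz]), hg1]
  · rw [restrictFibers_pow_apply_of_notMem _ (by simp [hz]), Perm.one_apply]

theorem eq_one_or_eq_of_card_eq_two {G : Type*} [Group G] {H : Subgroup G}
    (hH : Nat.card H = 2) {a h : G} (ha : a ∈ H) (ha1 : a ≠ 1) (hh : h ∈ H) : h = 1 ∨ h = a := by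
  obtain ⟨y, -, hy⟩ := (Nat.card_eq_two_iff' (1 : H)).mp hH
  by_cases h1 : h = 1
  · exact Or.inl h1
  · have e1 := hy ⟨a, ha⟩ (fun h => ha1 (congrArg Subtype.val h))
    have e2 := hy ⟨h, hh⟩ (fun h => h1 (congrArg Subtype.val h))
    exact Or.inr (congrArg Subtype.val (e2.trans e1.symm))

theorem part_ne_one (D : OrbitInvolution Q π t) (i : α) : D.part {i} ≠ 1 := by
  intro h
  obtain ⟨x, rfl⟩ := D.surjective i
  have := congrArg (fun p : Perm Ω => p x) h
  rw [part_apply, if_pos (Finset.mem_singleton_self _)] at this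
  exact D.apply_ne x this

/-- On an orbit of size `|Q| / 2`, the point stabilizer is generated by the central involution
moving another orbit. -/
theorem eq_one_or_eq_part (D : OrbitInvolution Q π t) {i j : α} (hij : i ≠ j)
    (hi : fiberCard π i * 2 = Nat.card Q) (hj : fiberCard π j ≠ 2) {y : Ω} (hy : π y = i)
    {h : Perm Ω} (hh : h ∈ Q) (hhy : h y = y) : h = 1 ∨ h = D.part {j} := by
  have h1 := D.fiberCard_mul_card_stabilizer y
  rw [hy, ← hi] at h1
  have h2 : Nat.card (Q ⊓ MulAction.stabilizer (Perm Ω) y : Subgroup (Perm Ω)) = 2 :=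
    Nat.eq_of_mul_eq_mul_left (by have := D.two_le_fiberCard i; omega) h1
  refine eq_one_or_eq_of_card_eq_two h2 ⟨D.part_mem (D.sign_part_of_ne_two hj), ?_⟩
    (D.part_ne_one j) ⟨hh, hhy⟩
  exact D.part_mem_stabilizer (by simp [hy, hij])

theorem false_of_odd_restriction (D : OrbitInvolution Q π t) {i j s : α} (hij : i ≠ j)
    (his : i ≠ s) (hjs : j ≠ s) (hs : fiberCard π s = 2)
    (hi : fiberCard π i * 2 = Nat.card Q) (hj : fiberCard π j * 2 = Nat.card Q)
    (hi2 : fiberCard π i ≠ 2) (hj2 : fiberCard π j ≠ 2) {g : Perm Ω} (hg : g ∈ Q)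
    (hodd : sign (g.restrictFibers π (D.map_of_mem hg) {i}) = -1) : False := by
  have hstab : ∀ y, π y = i → ∀ h ∈ Q, h y = y → ∀ z, π z = i → h z = z := by
    intro y hy h hh hhy z hz
    rcases D.eq_one_or_eq_part hij hi hj2 hy hh hhy with rfl | rfl
    · rfl
    · rw [part_apply, if_neg (by simp [hz, hij])]
  obtain ⟨hne, -, hcyc⟩ := D.restrictFibers_isCycle hg hodd hstab
  set u := g.restrictFibers π (D.map_of_mem hg) {i} with hu
  have hune : ∀ y, π y = i → u y ≠ y := fun y hy => by
    rw [hu, restrictFibers_apply, if_pos (by simp [hy])]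
    exact hne y hy
  have hucomm : ∀ q ∈ Q, q * u = u * q := by
    intro q hq
    refine restrictFibers_commute _ (D.map_of_mem hq) fun x hx => ?_
    have hx : π x = i := by simpa using hx
    obtain ⟨n, hn⟩ := hcyc.exists_pow_eq (hune x hx) (hune (q x) (by rw [D.map_of_mem hq, hx]))
    rw [hu, restrictFibers_pow_apply _ (by simp [hx])] at hn
    have hloc : ∀ z, π z = i → q z = (g ^ n) z := by
      intro z hz
      have := hstab x hx ((g ^ n)⁻¹ * q) (Q.mul_mem (Q.inv_mem (Q.pow_mem hg n)) hq)
        (by rw [Perm.mul_apply, Perm.inv_eq_iff_eq, hn]) z hz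
      rwa [Perm.mul_apply, Perm.inv_eq_iff_eq] at this
    rw [hloc x hx, hloc (g x) (by rw [D.map_of_mem hg, hx]), ← Perm.mul_apply, ← Perm.mul_apply,
      ← pow_succ, ← pow_succ']
  have hv : u * D.part {s} ∈ Q := by
    refine D.mem_of_commute _ (fun q hq => ?_) ?_
    · rw [← mul_assoc, hucomm q hq, mul_assoc, D.part_commute _ hq, mul_assoc]
    · rw [Perm.sign_mul, hodd, D.sign_part_of_eq_two hs]
      decide
  have hu_apply : ∀ y, π y ≠ i → u y = y := fun y hy => by
    rw [hu, restrictFibers_apply, if_neg (by simpa using hy)]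
  obtain ⟨y, hy⟩ := D.surjective j
  obtain ⟨z, hz⟩ := D.surjective s
  have hvy : (u * D.part {s}) y = y := by
    rw [Perm.mul_apply, part_apply, if_neg (by simp [hy, hjs]),
      hu_apply y (by rw [hy]; exact hij.symm)]
  have hvz : (u * D.part {s}) z = t z := by
    rw [Perm.mul_apply, part_apply, if_pos (by simp [hz]),
      hu_apply _ (by rw [D.map_apply, hz]; exact his.symm)]
  have hne' := D.apply_ne z
  rcases D.eq_one_or_eq_part hij.symm hj hi2 hy hv hvy with h | h
  · rw [h] at hvz
    exact hne' hvz.symm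
  · rw [h, part_apply, if_neg (by simp [hz, his.symm])] at hvz
    exact hne' hvz.symm

theorem false_of_three_orbits [Fintype α] (D : OrbitInvolution Q π t) {i j s : α} (hij : i ≠ j)
    (his : i ≠ s) (hjs : j ≠ s) (huniv : Finset.univ = {i, j, s}) (hs : fiberCard π s = 2)
    (hi : fiberCard π i * 2 = Nat.card Q) (hj : fiberCard π j * 2 = Nat.card Q)
    (hi2 : fiberCard π i ≠ 2) (hj2 : fiberCard π j ≠ 2) : False := by
  obtain ⟨x, rfl⟩ := D.surjective s
  obtain ⟨g, hg, hgx⟩ := D.exists_mem_apply_eq x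
  have hsign := D.sign_eq_one g hg
  rw [sign_eq_prod_restrictFibers (D.map_of_mem hg), huniv,
    Finset.prod_insert (by simp [hij, his]), Finset.prod_pair hjs,
    D.sign_restrictFibers_of_apply_ne hg hs (hgx ▸ D.apply_ne x)] at hsign
  rcases Int.units_eq_one_or (sign (g.restrictFibers π (D.map_of_mem hg) {i})) with h | h
  · rw [h, one_mul] at hsign
    refine D.false_of_odd_restriction hij.symm hjs his hs hj hi hj2 hi2 hg ?_
    simpa [neg_eq_iff_eq_neg] using hsign
  · exact D.false_of_odd_restriction hij his hjs hs hi hj hi2 hj2 hg h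

theorem false_of_two_small_orbits [Fintype α] (D : OrbitInvolution Q π t)
    (hα : Fintype.card α = 2) (h2 : ∀ i : α, fiberCard π i = 2) (hQ : Nat.card Q = 2) : False := by
  have htQ : D.part Finset.univ ∈ Q := by
    refine D.part_mem ?_
    rw [sign_part, Finset.prod_congr rfl (fun i _ => D.sign_part_of_eq_two (h2 i))]
    simp [hα]
  have ht : D.part Finset.univ = t := by
    ext x
    simp [part_apply]
  rw [ht] at htQ
  obtain ⟨i, j, hij, -⟩ := Finset.card_eq_two.mp ((Finset.card_univ (α := α)).trans hα)
  obtain ⟨a, rfl⟩ := D.surjective i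
  obtain ⟨c, rfl⟩ := D.surjective j
  have hac : a ≠ c := fun h => hij (by rw [h])
  have hat : a ≠ t a := (D.apply_ne a).symm
  have hatc : a ≠ t c := fun h => hij (by rw [h, D.map_apply])
  have hcta : c ≠ t a := fun h => hij (by rw [h, D.map_apply])
  have hct : c ≠ t c := (D.apply_ne c).symm
  have htt : t a ≠ t c := fun h => hac (t.injective h)
  have hdisj : (swap a c).Disjoint (swap (t a) (t c)) := disjoint_swap_swap (by
    simp [hac, hat, hatc, hcta, hct, htt])
  have hcomm : t * (swap a c * swap (t a) (t c)) = swap a c * swap (t a) (t c) * t := by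
    rw [← mul_assoc, mul_swap_eq_swap_mul t a c, mul_assoc, mul_swap_eq_swap_mul t (t a) (t c),
      D.apply_apply, D.apply_apply, ← mul_assoc, hdisj.commute.eq]
  have hmem : swap a c * swap (t a) (t c) ∈ Q := by
    refine D.mem_of_commute _ (fun q hq => ?_) ?_
    · rcases eq_one_or_eq_of_card_eq_two hQ htQ
        (fun h => hat (congrArg (fun p : Perm Ω => p a) h).symm) hq with rfl | rfl
      · rw [one_mul, mul_one]
      · exact hcomm
    · rw [Perm.sign_mul, sign_swap hac, sign_swap htt]
      decide
  have hmap := D.map_of_mem hmem a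
  rw [Perm.mul_apply, swap_apply_of_ne_of_ne hat hatc, swap_apply_left] at hmap
  exact hij hmap.symm

theorem isKleinFour_of_small_orbits (D : OrbitInvolution Q π t)
    (h2 : ∀ i : α, fiberCard π i = 2) (hQ : Nat.card Q = 4) : IsKleinFour Q := by
  refine ⟨hQ, ?_⟩
  have hsq : ∀ q ∈ Q, ∀ x, q (q x) = x := by
    intro q hq x
    by_contra hx
    have hq1 : q x ≠ x := fun h => hx (by rw [h, h])
    have hlt : 2 < fiberCard π (π x) :=
      Finset.two_lt_card.mpr ⟨x, by simp, q x, by simp [D.map_of_mem hq], q (q x),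
        by simp [D.map_of_mem hq], hq1.symm, Ne.symm hx, fun h => hq1 (q.injective h).symm⟩
    rw [h2] at hlt
    exact lt_irrefl _ hlt
  have hdvd : Monoid.exponent Q ∣ 2 := by
    refine Monoid.exponent_dvd_of_forall_pow_eq_one fun q => ?_
    ext x
    have h : (q.1 ^ 2) x = x := by rw [pow_two]; exact hsq q.1 q.2 x
    exact h
  refine ((Nat.dvd_prime Nat.prime_two).mp hdvd).resolve_left fun h1 => ?_
  have := Monoid.exp_eq_one_iff.mp h1
  rw [Nat.card_of_subsingleton 1] at hQ
  omega

theorem fiberCard_mul_eq_card_or_le (D : OrbitInvolution Q π t) {i : α} {c : ℕ}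
    (hle : fiberCard π i * 2 ^ c ≤ Nat.card Q) :
    fiberCard π i * 2 ^ c = Nat.card Q ∨ fiberCard π i * 2 ^ c * 2 ≤ Nat.card Q := by
  obtain ⟨a, ha⟩ := D.card_eq_two_pow
  obtain ⟨b, -, hb⟩ := (Nat.dvd_prime_pow Nat.prime_two).mp (ha ▸ D.fiberCard_dvd i)
  rw [hb, ha, ← pow_add] at hle ⊢
  rcases ((Nat.pow_le_pow_iff_right one_lt_two).mp hle).eq_or_lt with h | h
  · exact Or.inl (by rw [h])
  · right
    rw [← pow_succ]
    exact Nat.pow_le_pow_right two_pos h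

end Structure

theorem eq_one_and_le_two_of_two_pow_lt {m r : ℕ} (hm : 1 ≤ m) (hr : 1 ≤ r)
    (h : 2 * 2 ^ (m + r - 2) < 2 * m + r) : r = 1 ∧ m ≤ 2 := by
  obtain ⟨a, rfl⟩ := Nat.exists_eq_add_of_le' hm
  obtain ⟨b, rfl⟩ := Nat.exists_eq_add_of_le' hr
  rw [show a + 1 + (b + 1) - 2 = a + b by omega] at h
  have h1 : a + b < 2 ^ (a + b) := Nat.lt_two_pow_self
  obtain rfl : b = 0 := by omega
  refine ⟨rfl, ?_⟩
  rcases a with _ | _ | a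
  · omega
  · omega
  · have h2 : a < 2 ^ a := Nat.lt_two_pow_self
    rw [add_zero, pow_succ, pow_succ] at h
    omega

section Numeric

variable [Fintype α]

theorem small_orbits_of_card_lt (D : OrbitInvolution Q π t) (hlt : Nat.card Q < Nat.card Ω)
    (h2 : ∀ i : α, fiberCard π i = 2) : Fintype.card α = 3 ∧ Nat.card Q = 4 := by
  have hΩ : Nat.card Ω = Fintype.card α * 2 := by
    rw [card_eq_sum_fiberCard π, Finset.sum_congr rfl (fun i _ => h2 i)]
    simp
  obtain ⟨a, ha⟩ := D.card_eq_two_pow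
  have hpos : 0 < Nat.card Q := Nat.card_pos
  have hα : 0 < Fintype.card α := by omega
  obtain ⟨s⟩ := Fintype.card_pos_iff.mp hα
  have hle := D.two_pow_le (h2 s)
  have hsQ := Nat.le_of_dvd hpos (D.fiberCard_dvd s)
  rw [h2 s] at hsQ
  obtain ⟨k, hk⟩ := Nat.exists_eq_add_of_le' hα
  rw [hk, Nat.add_sub_cancel] at hle
  rw [hk] at hΩ
  rw [hΩ] at hlt
  have ha3 : a < 3 := by
    by_contra! h
    have h8 : 2 ^ 3 ≤ 2 ^ a := Nat.pow_le_pow_right two_pos h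
    rcases k with _ | _ | _ | k
    · omega
    · omega
    · omega
    · have h3 : k < 2 ^ k := Nat.lt_two_pow_self
      rw [pow_succ, pow_succ, pow_succ] at hle
      omega
  rcases k with _ | _ | _ | k
  · omega
  · exfalso
    refine D.false_of_two_small_orbits (by omega) h2 ?_
    interval_cases a <;> omega
  · refine ⟨by omega, ?_⟩
    interval_cases a <;> omega
  · have h3 : k < 2 ^ k := Nat.lt_two_pow_self
    rw [pow_succ, pow_succ, pow_succ] at hle
    omega

theorem exists_fiberCard_eq_two_of_card_lt (D : OrbitInvolution Q π t)
    (hlt : Nat.card Q < Nat.card Ω) : ∃ s : α, fiberCard π s = 2 := by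
  by_contra! h
  have hsum : Nat.card Ω * 2 ^ (Fintype.card α - 1) ≤ Fintype.card α * Nat.card Q := by
    rw [card_eq_sum_fiberCard π, Finset.sum_mul]
    refine (Finset.sum_le_card_nsmul _ _ _ fun i _ => D.fiberCard_mul_le_of_forall h i).trans ?_
    simp
  have h1 : Fintype.card α ≤ 2 ^ (Fintype.card α - 1) := by
    have : Fintype.card α - 1 < 2 ^ (Fintype.card α - 1) := Nat.lt_two_pow_self
    omega
  have h2 := Nat.mul_lt_mul_of_pos_right hlt (Nat.two_pow_pos (Fintype.card α - 1))
  have h3 := Nat.mul_le_mul_right (Nat.card Q) h1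
  rw [mul_comm (2 ^ _)] at h3
  omega

theorem exists_regular_orbit_of_card_lt (D : OrbitInvolution Q π t)
    (hlt : Nat.card Q < Nat.card Ω) {i₀ : α} (h0 : fiberCard π i₀ ≠ 2) :
    ∃ i s : α, i ≠ s ∧ Finset.univ = {i, s} ∧ fiberCard π s = 2 ∧
      fiberCard π i = Nat.card Q ∧ 4 ≤ Nat.card Q := by
  obtain ⟨s₀, hs₀⟩ := D.exists_fiberCard_eq_two_of_card_lt hlt
  let M : Finset α := Finset.univ.filter (fun i => ¬ fiberCard π i = 2)
  let R : Finset α := Finset.univ.filter (fun i => fiberCard π i = 2)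
  have hM : ∀ i ∈ M, fiberCard π i ≠ 2 := fun i hi => (Finset.mem_filter.mp hi).2
  have hR : ∀ i ∈ R, fiberCard π i = 2 := fun i hi => (Finset.mem_filter.mp hi).2
  have hMR : R.card + M.card = Fintype.card α :=
    Finset.card_filter_add_card_filter_not _
  have hm : 1 ≤ M.card := Finset.card_pos.mpr ⟨i₀, by simp [M, h0]⟩
  have hr : 1 ≤ R.card := Finset.card_pos.mpr ⟨s₀, by simp [R, hs₀]⟩
  have hbound : ∀ i ∈ M, fiberCard π i * 2 ^ (Fintype.card α - 2) ≤ Nat.card Q := fun i hi =>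
    D.fiberCard_mul_le hs₀ (fun h => hM i hi (h ▸ hs₀))
  have hsum : Nat.card Ω = R.card * 2 + ∑ i ∈ M, fiberCard π i := by
    rw [card_eq_sum_fiberCard π, ← Finset.sum_filter_add_sum_filter_not Finset.univ
      (fun i => fiberCard π i = 2)]
    congr 1
    rw [Finset.sum_congr rfl (fun i hi => (Finset.mem_filter.mp hi).2)]
    simp [R]
  have hsumM : (∑ i ∈ M, fiberCard π i) * 2 ^ (Fintype.card α - 2) ≤ M.card * Nat.card Q := by
    rw [Finset.sum_mul]
    exact Finset.sum_le_card_nsmul _ _ _ hbound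
  have hfour : 4 * 2 ^ (Fintype.card α - 2) ≤ Nat.card Q :=
    (Nat.mul_le_mul_right _ (D.four_le_fiberCard h0)).trans (hbound i₀ (by simp [M, h0]))
  have hk : Fintype.card α - 2 = M.card + R.card - 2 := by omega
  obtain ⟨hr1, hm2⟩ := eq_one_and_le_two_of_two_pow_lt hm hr (by
    rw [← hk]
    by_contra! hcon
    generalize 2 ^ (Fintype.card α - 2) = P at *
    have hP : 0 < P := by
      rcases Nat.eq_zero_or_pos P with rfl | h
      · omega
      · exact h
    have h1 : Nat.card Q * P < (R.card * 2 + ∑ i ∈ M, fiberCard π i) * P :=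
      Nat.mul_lt_mul_of_pos_right (by omega) hP
    have h2 := Nat.mul_le_mul_left (Nat.card Q) hcon
    have h3 := Nat.mul_le_mul_left R.card hfour
    nlinarith)
  obtain ⟨s, hRs⟩ := Finset.card_eq_one.mp hr1
  have hs : fiberCard π s = 2 := hR s (by simp [hRs])
  have huniv : Finset.univ = M ∪ R := by
    ext i
    simp only [M, R, Finset.mem_univ, Finset.mem_union, Finset.mem_filter, true_and, true_iff]
    tauto
  rcases (by omega : M.card = 1 ∨ M.card = 2) with h1 | h2
  · obtain ⟨i, hMi⟩ := Finset.card_eq_one.mp h1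
    have hi := hM i (by simp [hMi])
    have hc : Fintype.card α - 2 = 0 := by omega
    rw [hc] at hfour
    have hle := hbound i (by simp [hMi])
    rw [hc] at hle
    refine ⟨i, s, fun h => hi (h ▸ hs), ?_, hs, ?_, by omega⟩
    · rw [huniv, hMi, hRs]
      rfl
    · rw [hMi, Finset.sum_singleton] at hsum
      rcases D.fiberCard_mul_eq_card_or_le hle with h | h <;> omega
  · exfalso
    obtain ⟨i, j, hij, hMij⟩ := Finset.card_eq_two.mp h2
    have hi := hM i (by simp [hMij])
    have hj := hM j (by simp [hMij])
    have hc : Fintype.card α - 2 = 1 := by omega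
    have hile := hbound i (by simp [hMij])
    have hjle := hbound j (by simp [hMij])
    rw [hc] at hfour hile hjle
    rw [hMij, Finset.sum_pair hij] at hsum
    refine D.false_of_three_orbits hij (fun h => hi (h ▸ hs)) (fun h => hj (h ▸ hs)) ?_ hs ?_ ?_
      hi hj
    · rw [huniv, hMij, hRs]
      ext
      simp
    · rcases D.fiberCard_mul_eq_card_or_le hile with h | h <;> omega
    · rcases D.fiberCard_mul_eq_card_or_le hjle with h | h <;> omega

end Numeric

end OrbitInvolution

theorem card_permOrbit {Ω α : Type*} [Fintype Ω] [DecidableEq α] {Q : Subgroup (Perm Ω)}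
    {π : Ω → α} (hπ : ∀ x y, π x = π y ↔ ∃ q ∈ Q, q x = y) (x : Ω) :
    Nat.card (permOrbit Q x) = fiberCard π (π x) := by
  rw [fiberCard, ← Set.ncard_coe_finset, Nat.card_coe_set_eq]
  congr 1
  ext y
  simp only [permOrbit, Finset.coe_filter, Finset.mem_univ, true_and, Set.mem_ofPred_eq]
  rw [eq_comm, hπ]

theorem permOrbit_eq_iff {Ω α : Type*} {Q : Subgroup (Perm Ω)}
    {π : Ω → α} (hπ : ∀ x y, π x = π y ↔ ∃ q ∈ Q, q x = y) (x y : Ω) :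
    permOrbit Q x = permOrbit Q y ↔ π x = π y := by
  have hset : ∀ z, permOrbit Q z = {w | π z = π w} := fun z => Set.ext fun w => (hπ z w).symm
  rw [hset, hset]
  constructor
  · intro h
    have : y ∈ {w | π x = π w} := h ▸ (rfl : π y = π y)
    exact this
  · intro h
    rw [h]

theorem caseCyclic_or_caseKlein {Ω : Type*} [Fintype Ω] [DecidableEq Ω]
    {Q : Subgroup (Perm Ω)} (hQA : Q ≤ alternatingGroup Ω) (hQ2 : IsPGroup 2 Q)
    (hfpf : ∀ ω : Ω, ∃ q ∈ Q, q ω ≠ ω)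
    (hsc : Subgroup.centralizer (Q : Set (Perm Ω)) ⊓ alternatingGroup Ω
      = Subgroup.centralizer (Q : Set (Perm Ω)) ⊓ Q)
    (hlt : Nat.card Q < Nat.card Ω) : CaseCyclic Q ∨ CaseKlein Q := by
  classical
  let π : Ω → MulAction.orbitRel.Quotient Q Ω := Quotient.mk _
  have hπ : ∀ x y, π x = π y ↔ ∃ q ∈ Q, q x = y := by
    intro x y
    rw [eq_comm, Quotient.eq, MulAction.orbitRel_apply, MulAction.mem_orbit_iff]
    constructor
    · rintro ⟨q, h⟩
      exact ⟨q.1, q.2, h⟩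
    · rintro ⟨q, hq, h⟩
      exact ⟨⟨q, hq⟩, h⟩
  obtain ⟨t, ht1, ht2, ht3, ht4⟩ := exists_central_involution hQ2 hfpf
  have D : OrbitInvolution Q π t :=
    { map_eq_iff := hπ
      surjective := Quotient.mk_surjective
      isPGroup := hQ2
      sign_eq_one := fun q hq => mem_alternatingGroup.mp (hQA hq)
      mem_of_commute := fun u hu hs => by
        have : u ∈ Subgroup.centralizer (Q : Set (Perm Ω)) ⊓ alternatingGroup Ω :=
          ⟨Subgroup.mem_centralizer_iff.mpr hu, mem_alternatingGroup.mpr hs⟩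
        rw [hsc] at this
        exact this.2
      map_apply := fun x => ((hπ _ _).mpr (ht3 x)).symm
      apply_ne := ht1
      apply_apply := ht2
      comm := ht4 }
  have : Fintype (MulAction.orbitRel.Quotient Q Ω) := Fintype.ofFinite _
  have hcover : ∀ {S : Finset (MulAction.orbitRel.Quotient Q Ω)}, Finset.univ = S → ∀ ω, π ω ∈ S :=
    fun h ω => h ▸ Finset.mem_univ _
  by_cases h2 : ∀ i, fiberCard π i = 2
  · right
    obtain ⟨hα, hQ⟩ := D.small_orbits_of_card_lt hlt h2
    have hK := D.isKleinFour_of_small_orbits h2 hQ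
    obtain ⟨i, j, k, hij, hik, hjk, huniv⟩ :=
      Finset.card_eq_three.mp ((Finset.card_univ).trans hα)
    obtain ⟨x, rfl⟩ := D.surjective i
    obtain ⟨y, rfl⟩ := D.surjective j
    obtain ⟨z, rfl⟩ := D.surjective k
    refine ⟨?_, IsKleinFour.nonempty_mulEquiv, hQ, x, y, z, ?_, ?_, ?_, fun ω => ?_, ?_, ?_, ?_⟩
    · rw [card_eq_sum_fiberCard π, Finset.sum_congr rfl (fun i _ => h2 i)]
      simp [hα]
    · rwa [Ne, permOrbit_eq_iff hπ]
    · rwa [Ne, permOrbit_eq_iff hπ]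
    · rwa [Ne, permOrbit_eq_iff hπ]
    · simpa [permOrbit_eq_iff hπ] using hcover huniv ω
    · rw [card_permOrbit hπ, h2]
    · rw [card_permOrbit hπ, h2]
    · rw [card_permOrbit hπ, h2]
  · left
    obtain ⟨i₀, h0⟩ := not_forall.mp h2
    obtain ⟨i, s, his, huniv, hs, hi, h4⟩ := D.exists_regular_orbit_of_card_lt hlt h0
    have hcyc := D.isCyclic_of_regular_orbit his huniv hs hi
    obtain ⟨x, rfl⟩ := D.surjective i
    obtain ⟨y, rfl⟩ := D.surjective s
    refine ⟨?_, hcyc, h4, x, y, ?_, fun ω => ?_, ?_, ?_⟩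
    · rw [card_eq_sum_fiberCard π, huniv, Finset.sum_pair his, hi, hs]
    · rwa [Ne, permOrbit_eq_iff hπ]
    · simpa [permOrbit_eq_iff hπ] using hcover huniv ω
    · rw [card_permOrbit hπ, hi]
    · rw [card_permOrbit hπ, hs]

end SelfCentralizing

/-- Let `Ω` be a finite set and let `Q ≤ Alt(Ω)` be a `2`-subgroup of the
alternating group on `Ω` acting fixed point freely on `Ω` and satisfying
`C_{Alt(Ω)}(Q) = Z(Q)`. Then exactly one of the following holds: (i) `|Ω| ≤ |Q|`;
(ii) `|Ω| = |Q| + 2`, `Q` is cyclic of order at least `4`, and `Q` has exactly two orbits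
on `Ω`, of lengths `|Q|` and `2`; (iii) `|Ω| = 6`, `Q` is a Klein four-group, and `Q` has
exactly three orbits on `Ω`, each of length `2`. -/
theorem trichotomy_of_fixedPointFree_selfCentralizing
    (Ω : Type*) [Fintype Ω] [DecidableEq Ω]
    (Q : Subgroup (Equiv.Perm Ω)) (hQA : Q ≤ alternatingGroup Ω)
    (hQ2 : IsPGroup 2 Q)
    (hfpf : ∀ ω : Ω, ∃ q ∈ Q, q ω ≠ ω)
    (hsc : Subgroup.centralizer (Q : Set (Equiv.Perm Ω)) ⊓ alternatingGroup Ω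
      = Subgroup.centralizer (Q : Set (Equiv.Perm Ω)) ⊓ Q) :
    (CaseSmall Q ∧ ¬ CaseCyclic Q ∧ ¬ CaseKlein Q) ∨
    (¬ CaseSmall Q ∧ CaseCyclic Q ∧ ¬ CaseKlein Q) ∨
    (¬ CaseSmall Q ∧ ¬ CaseCyclic Q ∧ CaseKlein Q) := by
  by_cases hsmall : CaseSmall Q
  · refine Or.inl ⟨hsmall, fun h => ?_, fun h => ?_⟩
    · have h1 := h.1
      unfold CaseSmall at hsmall
      omega
    · have h1 := h.1
      have h2 := h.2.2.1
      unfold CaseSmall at hsmall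
      omega
  · have hexcl : ¬ (CaseCyclic Q ∧ CaseKlein Q) := by
      rintro ⟨hc, hk⟩
      obtain ⟨-, hcyc, -⟩ := hc
      obtain ⟨-, ⟨e⟩, -⟩ := hk
      have := isCyclic_of_surjective e e.surjective
      exact IsKleinFour.not_isCyclic this
    have h := SelfCentralizing.caseCyclic_or_caseKlein hQA hQ2 hfpf hsc (not_le.mp hsmall)
    tauto
end
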